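/- arXiv:1305.7352 — 3 statements merged into one kernel-verified Lean document; each statement's English description precedes it below -/
import Mathlib

section
/- Let q < 2, N > 0 and M ≥ 0 with M ≠ N − q. There is a constant C, depending only on N, M and q, such that for all z ∈ 𝔻: ∫_𝔻 (1−|w|²)^{N−1} / (|1 − z·conj(w)|^{1+M} · |w−z|^q) dν(w) ≤ C · (1 + (1−|z|²)^{N−M−q}). -/
open MeasureTheory Filter Set Real Complex
open scoped ENNReal NNReal Topology

noncomputable section

/-- The open unit disk in `ℂ`. -/
def UD : Set ℂ := Metric.ball 0 1

/-- The Lebesgue area measure on the unit disk, normalized so that `ν(𝔻) = 1`. -/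
def nuM : Measure ℂ := (ENNReal.ofReal π⁻¹) • (volume.restrict UD)

/-- The weight `t(1-|z|²)^{t-1}` of the measure `ν_t`. -/
def wt (t : ℝ) (z : ℂ) : ℝ := t * (1 - ‖z‖ ^ 2) ^ (t - 1)

/-- The measure `ν_t = t(1-|z|²)^{t-1} dν`. -/
def nuT (t : ℝ) : Measure ℂ := nuM.withDensity fun z => ENNReal.ofReal (wt t z)

/-- The conjugate exponent `p' = p/(p-1)`. -/
def conjExp (p : ℝ) : ℝ := p / (p - 1)

/-- The operator `(1+R)`, where `R` is the radial derivative `Rf(z) = z f'(z)`. -/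
def opR (f : ℂ → ℂ) : ℂ → ℂ := fun z => f z + z * deriv f z

/-- The operator `R^k_L = (1 + R/(L+k-1)) ∘ ⋯ ∘ (1 + R/L)`. -/
def RkL (L : ℝ) : ℕ → (ℂ → ℂ) → ℂ → ℂ
  | 0 => fun f => f
  | k + 1 => fun f z => RkL L k f z + z * deriv (RkL L k f) z / (L + k)

/-- The tent `T_z`. -/
def tent (z : ℂ) : Set ℂ :=
  if z = 0 then UD
  else {w ∈ UD | ‖1 - w * (starRingEnd ℂ) z / (‖z‖ : ℂ)‖ < 2 * (1 - ‖z‖ ^ 2)}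

/-- The measure `μ_t = θ dν_t` (with the convention `dμ_0 = (1-|z|²)⁻¹ dν`). -/
def muT (t : ℝ) (θ : ℂ → ℝ) : Measure ℂ :=
  if t = 0 then nuM.withDensity fun z => ENNReal.ofReal (1 - ‖z‖ ^ 2)⁻¹
  else nuM.withDensity fun z => ENNReal.ofReal (θ z * wt t z)

/-- The measure `μ′_t = θ^{-p'/p} dν_t` (with the convention `dμ′_0 = (1-|z|²)⁻¹ dν`). -/
def muT' (p t : ℝ) (θ : ℂ → ℝ) : Measure ℂ :=
  if t = 0 then nuM.withDensity fun z => ENNReal.ofReal (1 - ‖z‖ ^ 2)⁻¹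
  else nuM.withDensity fun z => ENNReal.ofReal (θ z ^ (-(conjExp p) / p) * wt t z)

/-- The quotient appearing in the Békollé condition. -/
def bekRatio (p t : ℝ) (θ : ℂ → ℝ) (z : ℂ) : ℝ :=
  ((muT t θ (tent z)).toReal / (nuT t (tent z)).toReal) ^ (1 / p) *
    ((muT' p t θ (tent z)).toReal / (nuT t (tent z)).toReal) ^ (1 / conjExp p)

/-- The Békollé constant `B_{p,t}(θ)`, as an extended nonnegative real
(with the convention `B_{p,0}(θ) = 1`). -/
def bekConst (p t : ℝ) (θ : ℂ → ℝ) : ℝ≥0∞ :=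
  if t = 0 then 1 else ⨆ z ∈ UD, ENNReal.ofReal (bekRatio p t θ z)

/-- `θ ∈ B_{p,t}` (with the convention that for `t = 0`, `θ ≡ 1`). -/
def IsBekolle (p t : ℝ) (θ : ℂ → ℝ) : Prop :=
  if t = 0 then θ = fun _ => 1
  else (∀ z, 0 ≤ θ z) ∧ (∫⁻ z, ENNReal.ofReal (θ z * wt t z) ∂nuM) < ⊤ ∧
    bekConst p t θ < ⊤

/-- `k_s`, the least nonnegative integer `> s`. -/
def kS (s : ℝ) : ℕ := if s < 0 then 0 else Nat.floor s + 1

/-- The weighted Besov norm `‖f‖_{B^p_s(μ_t)}`. -/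
def besov (p s t : ℝ) (θ : ℂ → ℝ) (f : ℂ → ℂ) : ℝ≥0∞ :=
  (∫⁻ z, ENNReal.ofReal
      (‖(opR^[kS s] f) z‖ ^ p * (1 - ‖z‖ ^ 2) ^ (((kS s : ℝ) - s) * p)) ∂(muT t θ)) ^ (1 / p)

/-- The weighted Besov norm `‖g‖_{B^{p'}_s(μ′_t)}`. -/
def besov' (p s t : ℝ) (θ : ℂ → ℝ) (g : ℂ → ℂ) : ℝ≥0∞ :=
  (∫⁻ z, ENNReal.ofReal
      (‖(opR^[kS s] g) z‖ ^ conjExp p *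
        (1 - ‖z‖ ^ 2) ^ (((kS s : ℝ) - s) * conjExp p)) ∂(muT' p t θ)) ^ (1 / conjExp p)

/-- The norm `‖b‖_{CB^p_s(μ_t)}`. -/
def cbNorm (p s t : ℝ) (θ : ℂ → ℝ) (b : ℂ → ℂ) : ℝ≥0∞ :=
  ⨆ (f : ℂ → ℂ) (_ : DifferentiableOn ℂ f UD) (_ : 0 < besov p s t θ f)
      (_ : besov p s t θ f < ⊤),
    (∫⁻ z, ENNReal.ofReal
        (‖f z‖ ^ p * ‖opR b z‖ ^ p * (1 - ‖z‖ ^ 2) ^ ((1 - s) * p)) ∂(muT t θ)) ^ (1 / p) /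
      besov p s t θ f

/-- `f ∈ H(𝔻̄)`: holomorphic on an open neighborhood of the closed unit disk. -/
def HolCl (f : ℂ → ℂ) : Prop :=
  ∃ U : Set ℂ, IsOpen U ∧ Metric.closedBall (0 : ℂ) 1 ⊆ U ∧ DifferentiableOn ℂ f U

/-- The dilated pairing `⟨⟨h(r·), b(r·)⟩⟩_t` (circle integral for `t = 0`). -/
def pairFn (t : ℝ) (h b : ℂ → ℂ) (r : ℝ) : ℂ :=
  if t = 0 then
    (2 * π)⁻¹ • ∫ x in (0:ℝ)..(2 * π),
      h ((r : ℂ) * Complex.exp (x * Complex.I)) *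
        (starRingEnd ℂ) (b ((r : ℂ) * Complex.exp (x * Complex.I)))
  else ∫ z, h ((r : ℂ) * z) * (starRingEnd ℂ) (b ((r : ℂ) * z)) * ((wt t z : ℝ) : ℂ) ∂nuM

/-- The pairing `⟨h, b⟩_t` exists and equals `L`. -/
def HasPairing (t : ℝ) (h b : ℂ → ℂ) (L : ℂ) : Prop :=
  Tendsto (pairFn t h b) (𝓝[<] (1 : ℝ)) (𝓝 L)

/-- `|⟨h,b⟩_t|` as an extended nonnegative real, `∞` if the pairing does not exist. -/
def pairNorm (t : ℝ) (h b : ℂ → ℂ) : ℝ≥0∞ :=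
  ⨅ (L : ℂ) (_ : HasPairing t h b L), ENNReal.ofReal ‖L‖

/-- Powers of comparable positive reals are comparable. -/
lemma rpow_le_of_comparable {x y K : ℝ} (e : ℝ) (hK : 0 < K) (hx : 0 < x) (hy : 0 < y)
    (h1 : x ≤ K * y) (h2 : y ≤ K * x) : x ^ e ≤ K ^ |e| * y ^ e := by
  rcases le_or_gt 0 e with he | he
  · rw [abs_of_nonneg he, ← Real.mul_rpow hK.le hy.le]
    exact Real.rpow_le_rpow hx.le h1 he
  · rw [abs_of_neg he, Real.rpow_neg hK.le, ← Real.inv_rpow hK.le,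
      ← Real.mul_rpow (inv_nonneg.2 hK.le) hy.le]
    refine Real.rpow_le_rpow_of_nonpos (by positivity) ?_ he.le
    rw [inv_mul_le_iff₀ hK]
    exact h2

lemma lintegral_Ioo_rpow {s R : ℝ} (hs : 0 < s) (hR : 0 ≤ R) :
    ∫⁻ u in Ioo 0 R, ENNReal.ofReal (u ^ (s - 1)) = ENNReal.ofReal (R ^ s / s) := by
  have hint : IntegrableOn (fun u : ℝ => u ^ (s - 1)) (Ioc 0 R) :=
    (intervalIntegrable_iff_integrableOn_Ioc_of_le hR).1
      (intervalIntegral.intervalIntegrable_rpow' (by linarith))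
  rw [restrict_Ioo_eq_restrict_Ioc, ← ofReal_integral_eq_lintegral_ofReal hint,
    ← intervalIntegral.integral_of_le hR, integral_rpow (Or.inl (by linarith))]
  · simp [Real.zero_rpow hs.ne']
  · exact ae_restrict_of_forall_mem measurableSet_Ioc fun u hu => Real.rpow_nonneg hu.1.le _

lemma lintegral_Ioi_rpow {s R : ℝ} (hs : s < 0) (hR : 0 < R) :
    ∫⁻ u in Ioi R, ENNReal.ofReal (u ^ (s - 1)) = ENNReal.ofReal (R ^ s / (-s)) := by
  rw [← ofReal_integral_eq_lintegral_ofReal (integrableOn_Ioi_rpow_of_lt (by linarith) hR),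
    integral_Ioi_rpow_of_lt (by linarith) hR]
  · simp [div_neg, neg_div]
  · exact ae_restrict_of_forall_mem measurableSet_Ioi fun u hu =>
      Real.rpow_nonneg (hR.trans hu).le _

lemma lintegral_rpow_mul_add_rpow_le_of_lt {s α R δ : ℝ} (hα : 0 ≤ α) (hs : α < s) (hR : 0 ≤ R)
    (hδ : 0 < δ) :
    ∫⁻ u in Ioo 0 R, ENNReal.ofReal (u ^ (s - 1) * (δ + u) ^ (-α)) ≤
      ENNReal.ofReal (R ^ (s - α) / (s - α)) := by
  rw [← lintegral_Ioo_rpow (sub_pos.2 hs) hR]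
  refine setLIntegral_mono' measurableSet_Ioo fun u hu => ENNReal.ofReal_le_ofReal ?_
  have hu0 := hu.1
  calc u ^ (s - 1) * (δ + u) ^ (-α) ≤ u ^ (s - 1) * u ^ (-α) :=
        mul_le_mul_of_nonneg_left
          (Real.rpow_le_rpow_of_nonpos hu0 (by linarith) (by linarith)) (by positivity)
    _ = u ^ (s - α - 1) := by rw [← Real.rpow_add hu0]; ring_nf

lemma lintegral_rpow_mul_add_rpow_le_of_gt {s α R δ : ℝ} (hs : 0 < s) (hα : s < α)
    (hδ : 0 < δ) :
    ∫⁻ u in Ioo 0 R, ENNReal.ofReal (u ^ (s - 1) * (δ + u) ^ (-α)) ≤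
      ENNReal.ofReal ((1 / s + 1 / (α - s)) * δ ^ (s - α)) := by
  have hsub : Ioo 0 R ⊆ Ioc 0 δ ∪ Ioi δ := by
    intro u hu
    rcases le_or_gt u δ with h | h
    · exact Or.inl ⟨hu.1, h⟩
    · exact Or.inr h
  refine (lintegral_mono_set hsub).trans ((lintegral_union_le _ _ _).trans ?_)
  have hnear : ∫⁻ u in Ioc 0 δ, ENNReal.ofReal (u ^ (s - 1) * (δ + u) ^ (-α)) ≤
      ENNReal.ofReal (1 / s * δ ^ (s - α)) := by
    calc ∫⁻ u in Ioc 0 δ, ENNReal.ofReal (u ^ (s - 1) * (δ + u) ^ (-α))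
        ≤ ∫⁻ u in Ioc 0 δ, ENNReal.ofReal (δ ^ (-α)) * ENNReal.ofReal (u ^ (s - 1)) := by
          refine setLIntegral_mono' measurableSet_Ioc fun u hu => ?_
          have hu0 := hu.1
          rw [← ENNReal.ofReal_mul (by positivity), mul_comm (δ ^ (-α))]
          gcongr ENNReal.ofReal (_ * ?_)
          exact Real.rpow_le_rpow_of_nonpos hδ (by linarith) (by linarith)
      _ = ENNReal.ofReal (1 / s * δ ^ (s - α)) := by
          rw [lintegral_const_mul' _ _ ENNReal.ofReal_ne_top, ← restrict_Ioo_eq_restrict_Ioc,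
            lintegral_Ioo_rpow hs hδ.le, ← ENNReal.ofReal_mul (by positivity), sub_eq_add_neg,
            Real.rpow_add hδ]
          congr 1
          ring
  have hfar : ∫⁻ u in Ioi δ, ENNReal.ofReal (u ^ (s - 1) * (δ + u) ^ (-α)) ≤
      ENNReal.ofReal (1 / (α - s) * δ ^ (s - α)) := by
    have hE : 1 / (α - s) * δ ^ (s - α) = δ ^ (s - α) / (-(s - α)) := by rw [neg_sub]; ring
    rw [hE, ← lintegral_Ioi_rpow (by linarith) hδ]
    refine setLIntegral_mono' measurableSet_Ioi fun u hu => ENNReal.ofReal_le_ofReal ?_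
    have hu0 : 0 < u := hδ.trans hu
    calc u ^ (s - 1) * (δ + u) ^ (-α) ≤ u ^ (s - 1) * u ^ (-α) :=
          mul_le_mul_of_nonneg_left
            (Real.rpow_le_rpow_of_nonpos hu0 (by linarith) (by linarith)) (by positivity)
      _ = u ^ (s - α - 1) := by rw [← Real.rpow_add hu0]; ring_nf
  have : 0 < α - s := sub_pos.2 hα
  rw [add_mul, ENNReal.ofReal_add (by positivity) (by positivity)]
  exact add_le_add hnear hfar

lemma setLIntegral_abs_le (f : ℝ → ℝ≥0∞) (R : ℝ) :
    ∫⁻ θ in Ioo (-R) R, f |θ| ≤ 2 * ∫⁻ θ in Ioo 0 R, f θ := by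
  have hsub : Ioo (-R) R ⊆ (Ioo (-R) 0 ∪ Ioo 0 R) ∪ {0} := by
    intro θ hθ
    rcases lt_trichotomy θ 0 with h | h | h
    · exact Or.inl (Or.inl ⟨hθ.1, h⟩)
    · exact Or.inr h
    · exact Or.inl (Or.inr ⟨h, hθ.2⟩)
  have hneg : ∫⁻ θ in Ioo (-R) 0, f |θ| = ∫⁻ θ in Ioo 0 R, f θ := by
    have h := (Measure.measurePreserving_neg (volume : Measure ℝ)).setLIntegral_comp_preimage_emb
      (Homeomorph.neg ℝ).measurableEmbedding f (Ioo 0 R)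
    rw [← h]
    simp only [neg_preimage, neg_Ioo, neg_zero]
    refine setLIntegral_congr_fun measurableSet_Ioo fun θ hθ => ?_
    simp only [abs_of_neg hθ.2]
  have hpos : ∫⁻ θ in Ioo 0 R, f |θ| = ∫⁻ θ in Ioo 0 R, f θ := by
    refine setLIntegral_congr_fun measurableSet_Ioo fun θ hθ => ?_
    simp only [abs_of_pos hθ.1]
  have hzero : ∫⁻ θ in ({0} : Set ℝ), f |θ| = 0 := by simp
  calc ∫⁻ θ in Ioo (-R) R, f |θ|
      ≤ ∫⁻ θ in (Ioo (-R) 0 ∪ Ioo 0 R) ∪ {0}, f |θ| := lintegral_mono_set hsub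
    _ ≤ (∫⁻ θ in Ioo (-R) 0, f |θ|) + (∫⁻ θ in Ioo 0 R, f |θ|) +
        ∫⁻ θ in ({0} : Set ℝ), f |θ| :=
        (lintegral_union_le _ _ _).trans (add_le_add (lintegral_union_le _ _ _) le_rfl)
    _ = 2 * ∫⁻ θ in Ioo 0 R, f θ := by rw [hneg, hpos, hzero, add_zero, two_mul]

lemma setLIntegral_ball_le_of_polar {F : ℂ → ℝ≥0∞} {G H : ℝ → ℝ≥0∞} {R : ℝ}
    (hG : Measurable G) (hH : Measurable H)
    (h : ∀ r ∈ Ioo 0 R, ∀ θ ∈ Ioo (-π) π,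
      ENNReal.ofReal r * F (r * (Real.cos θ + Real.sin θ * Complex.I)) ≤ G r * H θ) :
    ∫⁻ w in Metric.ball 0 R, F w ≤ (∫⁻ r in Ioo 0 R, G r) * ∫⁻ θ in Ioo (-π) π, H θ := by
  rw [← lintegral_indicator Metric.isOpen_ball.measurableSet,
    ← Complex.lintegral_comp_polarCoord_symm, ← lintegral_prod_mul hG.aemeasurable hH.aemeasurable,
    Measure.prod_restrict, ← lintegral_indicator (measurableSet_Ioo.prod measurableSet_Ioo)]
  change ∫⁻ p in Ioi (0 : ℝ) ×ˢ Ioo (-π) π, _ ≤ _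
  rw [← lintegral_indicator (measurableSet_Ioi.prod measurableSet_Ioo)]
  refine lintegral_mono fun p => ?_
  by_cases hp : p ∈ Ioi (0 : ℝ) ×ˢ Ioo (-π) π
  · rw [indicator_of_mem hp]
    have hp1 : 0 < p.1 := hp.1
    have hnorm : ‖Complex.polarCoord.symm p‖ = p.1 := by
      rw [Complex.norm_polarCoord_symm, abs_of_pos hp1]
    by_cases hR : p.1 < R
    · rw [indicator_of_mem (mem_ball_zero_iff.2 (hnorm.trans_lt hR)),
        indicator_of_mem (show p ∈ Ioo 0 R ×ˢ Ioo (-π) π from ⟨⟨hp1, hR⟩, hp.2⟩),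
        Complex.polarCoord_symm_apply, smul_eq_mul]
      exact h _ ⟨hp1, hR⟩ _ hp.2
    · rw [indicator_of_notMem (by rw [mem_ball_zero_iff, hnorm]; exact hR)]
      simp
  · simp [indicator_of_notMem hp]

lemma sq_norm_one_sub_mul_conj_polar (s θ : ℝ) :
    ‖1 - (s : ℂ) * (starRingEnd ℂ) (Real.cos θ + Real.sin θ * Complex.I)‖ ^ 2 =
      (1 - s) ^ 2 + 2 * s * (1 - Real.cos θ) := by
  rw [← Complex.normSq_eq_norm_sq, Complex.normSq_apply]
  simp only [map_add, map_mul, Complex.conj_ofReal, Complex.conj_I, Complex.sub_re, Complex.sub_im,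
    Complex.mul_re, Complex.mul_im, Complex.add_re, Complex.add_im, Complex.ofReal_re,
    Complex.ofReal_im, Complex.one_re, Complex.one_im, Complex.neg_re, Complex.neg_im,
    Complex.I_re, Complex.I_im]
  linear_combination s ^ 2 * Real.sin_sq_add_cos_sq θ

lemma one_sub_le_norm_one_sub_mul_conj_polar {s θ : ℝ} (hs : 0 ≤ s) :
    1 - s ≤ ‖1 - (s : ℂ) * (starRingEnd ℂ) (Real.cos θ + Real.sin θ * Complex.I)‖ := by
  refine le_of_abs_le (abs_le_of_sq_le_sq ?_ (norm_nonneg _))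
  rw [sq_norm_one_sub_mul_conj_polar]
  nlinarith [Real.cos_le_one θ, mul_nonneg hs (sub_nonneg.2 (Real.cos_le_one θ))]

lemma abs_le_norm_one_sub_mul_conj_polar {s θ : ℝ} (hs : 0 ≤ s) (hθ : |θ| ≤ π) :
    |θ| ≤ 2 * π * ‖1 - (s : ℂ) * (starRingEnd ℂ) (Real.cos θ + Real.sin θ * Complex.I)‖ := by
  refine abs_le_of_sq_le_sq ?_ (by positivity)
  rw [mul_pow, sq_norm_one_sub_mul_conj_polar]
  have hcos : 2 * θ ^ 2 ≤ π ^ 2 * (1 - Real.cos θ) := by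
    have h := Real.cos_le_one_sub_mul_cos_sq hθ
    have hpi : 0 < π ^ 2 := by positivity
    calc 2 * θ ^ 2 = π ^ 2 * (2 / π ^ 2 * θ ^ 2) := by field_simp
      _ ≤ π ^ 2 * (1 - Real.cos θ) := by gcongr; linarith
  have hθ2 : θ ^ 2 ≤ π ^ 2 := sq_le_sq.2 (hθ.trans (le_abs_self π))
  have hc : 0 ≤ 1 - Real.cos θ := sub_nonneg.2 (Real.cos_le_one θ)
  rcases le_total s (1 / 2) with h | h
  · have h1 : π ^ 2 * 1 ≤ π ^ 2 * (4 * (1 - s) ^ 2) := by gcongr; nlinarith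
    have h2 : 0 ≤ π ^ 2 * (s * (1 - Real.cos θ)) := by positivity
    nlinarith
  · have h1 : π ^ 2 * (1 - Real.cos θ) * 1 ≤ π ^ 2 * (1 - Real.cos θ) * (2 * s) := by
      gcongr; linarith
    have h2 : 0 ≤ π ^ 2 * (1 - s) ^ 2 := by positivity
    nlinarith [sq_nonneg θ]

lemma rpow_neg_norm_one_sub_mul_conj_polar_le {ρ r θ α β : ℝ} (hρ : 0 ≤ ρ) (hρ1 : ρ < 1)
    (hr : 0 ≤ r) (hr1 : r ≤ 1) (hθ : |θ| ≤ π) (hα : 0 ≤ α) (hβ : 0 ≤ β) :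
    ‖1 - (ρ : ℂ) * (starRingEnd ℂ) (r * (Real.cos θ + Real.sin θ * Complex.I))‖ ^ (-(α + β)) ≤
      (4 * π) ^ (α + β) * ((1 - ρ + (1 - r)) ^ (-α) * (1 - ρ + |θ|) ^ (-β)) := by
  have hs : 0 ≤ ρ * r := mul_nonneg hρ hr
  have h1 := one_sub_le_norm_one_sub_mul_conj_polar (θ := θ) hs
  have h2 := abs_le_norm_one_sub_mul_conj_polar hs hθ
  have hX : (1 : ℂ) - (ρ : ℂ) * (starRingEnd ℂ) (r * (Real.cos θ + Real.sin θ * Complex.I)) =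
      1 - ((ρ * r : ℝ) : ℂ) * (starRingEnd ℂ) (Real.cos θ + Real.sin θ * Complex.I) := by
    rw [map_mul, Complex.conj_ofReal, Complex.ofReal_mul, mul_assoc]
  rw [hX]
  set X := ‖1 - ((ρ * r : ℝ) : ℂ) * (starRingEnd ℂ) (Real.cos θ + Real.sin θ * Complex.I)‖
  have hρr : ρ * r ≤ ρ := mul_le_of_le_one_right hρ hr1
  have hρr' : ρ * r ≤ r := mul_le_of_le_one_left hr hρ1.le
  have hδ : 0 < 1 - ρ := by linarith
  have hX0 : 0 < X := by linarith
  have hpi : 3 < π := Real.pi_gt_three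
  have hA : 1 - ρ + (1 - r) ≤ 4 * π * X := by nlinarith
  have hB : 1 - ρ + |θ| ≤ 4 * π * X := by nlinarith
  have key : ∀ {A γ : ℝ}, 0 < A → A ≤ 4 * π * X → 0 ≤ γ →
      X ^ (-γ) ≤ (4 * π) ^ γ * A ^ (-γ) := by
    intro A γ hA0 hA hγ
    calc X ^ (-γ) = (4 * π) ^ γ * (4 * π * X) ^ (-γ) := by
          rw [Real.mul_rpow (by positivity) hX0.le, ← mul_assoc, ← Real.rpow_add (by positivity)]
          simp
      _ ≤ (4 * π) ^ γ * A ^ (-γ) :=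
          mul_le_mul_of_nonneg_left (Real.rpow_le_rpow_of_nonpos hA0 hA (by linarith))
            (by positivity)
  calc X ^ (-(α + β)) = X ^ (-α) * X ^ (-β) := by rw [← Real.rpow_add hX0]; ring_nf
    _ ≤ ((4 * π) ^ α * (1 - ρ + (1 - r)) ^ (-α)) * ((4 * π) ^ β * (1 - ρ + |θ|) ^ (-β)) := by
        have hr' : 0 ≤ 1 - r := by linarith
        refine mul_le_mul (key (by positivity) hA hα) (key (by positivity) hB hβ)
          (by positivity) (by positivity)
    _ = _ := by rw [Real.rpow_add (by positivity)]; ring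

lemma one_sub_sq_rpow_le {r e : ℝ} (hr : 0 ≤ r) (hr1 : r < 1) :
    (1 - r ^ 2) ^ e ≤ 2 ^ |e| * (1 - r) ^ e :=
  rpow_le_of_comparable e two_pos (by nlinarith) (by linarith) (by nlinarith) (by nlinarith)

lemma lintegral_kernel_ofReal_le {N α β : ℝ} (hα : 0 ≤ α) (hβ : 0 ≤ β) {ρ : ℝ}
    (hρ : 0 ≤ ρ) (hρ1 : ρ < 1) :
    ∫⁻ w in Metric.ball (0 : ℂ) 1, ENNReal.ofReal ((1 - ‖w‖ ^ 2) ^ (N - 1) *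
        ‖1 - (ρ : ℂ) * (starRingEnd ℂ) w‖ ^ (-(α + β))) ≤
      ENNReal.ofReal (2 ^ |N - 1| * (4 * π) ^ (α + β)) *
        ((∫⁻ u in Ioo 0 1, ENNReal.ofReal (u ^ (N - 1) * (1 - ρ + u) ^ (-α))) *
        (2 * ∫⁻ u in Ioo 0 π, ENNReal.ofReal (u ^ ((1 : ℝ) - 1) * (1 - ρ + u) ^ (-β)))) := by
  set K : ℝ := 2 ^ |N - 1| * (4 * π) ^ (α + β)
  set g : ℝ → ℝ≥0∞ := fun u => ENNReal.ofReal (u ^ (N - 1) * (1 - ρ + u) ^ (-α)) with hg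
  set f : ℝ → ℝ≥0∞ := fun u => ENNReal.ofReal (u ^ ((1 : ℝ) - 1) * (1 - ρ + u) ^ (-β)) with hf
  have hgm : Measurable g := by fun_prop
  have hfm : Measurable f := by fun_prop
  have hreflect : ∫⁻ r in Ioo 0 1, g (1 - r) = ∫⁻ u in Ioo 0 1, g u := by
    have h := (Measure.measurePreserving_sub_left
      (volume : Measure ℝ) 1).setLIntegral_comp_preimage_emb
      (Homeomorph.subLeft (1 : ℝ)).measurableEmbedding g (Ioo 0 1)
    rw [← h]
    simp
  calc _ ≤ (∫⁻ r in Ioo 0 1, ENNReal.ofReal K * g (1 - r)) * ∫⁻ θ in Ioo (-π) π, f |θ| := by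
        refine setLIntegral_ball_le_of_polar (by fun_prop) (by fun_prop) fun r hr θ hθ => ?_
        have hr0 := hr.1
        have hr1 := hr.2
        have hθ' : |θ| ≤ π := (abs_lt.2 hθ).le
        have hnorm : ‖(r : ℂ) * (Real.cos θ + Real.sin θ * Complex.I)‖ = r := by
          rw [← Complex.polarCoord_symm_apply (r, θ), Complex.norm_polarCoord_symm, abs_of_pos hr0]
        have hP := rpow_neg_norm_one_sub_mul_conj_polar_le hρ hρ1 hr0.le hr1.le hθ' hα hβ
        have hW := one_sub_sq_rpow_le (e := N - 1) hr0.le hr1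
        have hu : 0 < 1 - r := by linarith
        have hsq : 0 < 1 - r ^ 2 := by nlinarith
        have hδ : 0 < 1 - ρ := by linarith
        rw [hnorm, hg, hf]
        simp only
        rw [← ENNReal.ofReal_mul hr0.le, ← ENNReal.ofReal_mul (by positivity),
          ← ENNReal.ofReal_mul (by positivity)]
        refine ENNReal.ofReal_le_ofReal ?_
        rw [sub_self, Real.rpow_zero, one_mul]
        calc _ ≤ 1 * ((2 ^ |N - 1| * (1 - r) ^ (N - 1)) * ((4 * π) ^ (α + β) *
              ((1 - ρ + (1 - r)) ^ (-α) * (1 - ρ + |θ|) ^ (-β)))) := by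
              gcongr
          _ = _ := by simp only [K]; ring
    _ ≤ _ := by
        rw [lintegral_const_mul' _ _ ENNReal.ofReal_ne_top, hreflect, mul_assoc]
        gcongr
        exact setLIntegral_abs_le f π

lemma exists_lintegral_kernel_ofReal_le {N a : ℝ} (hN : 0 < N) (ha : 0 ≤ a) (haN : a ≠ N + 1) :
    ∃ C : ℝ, 0 < C ∧ ∀ ρ : ℝ, 0 ≤ ρ → ρ < 1 →
      ∫⁻ w in Metric.ball (0 : ℂ) 1, ENNReal.ofReal ((1 - ‖w‖ ^ 2) ^ (N - 1) *
        ‖1 - (ρ : ℂ) * (starRingEnd ℂ) w‖ ^ (-a)) ≤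
      ENNReal.ofReal (C * (1 + (1 - ρ) ^ (N + 1 - a))) := by
  obtain ⟨α, β, hα, hβ, hab, hαN⟩ : ∃ α β : ℝ, 0 ≤ α ∧ 0 ≤ β ∧ α + β = a ∧ α = N * β :=
    ⟨N * (a / (N + 1)), a / (N + 1), by positivity, by positivity, by field_simp, rfl⟩
  have hK : 0 < 2 ^ |N - 1| * (4 * π) ^ (α + β) := by positivity
  set K : ℝ := 2 ^ |N - 1| * (4 * π) ^ (α + β) with hKdef
  rcases haN.lt_or_gt with hlt | hgt
  · have hβ1 : β < 1 := by by_contra! h; nlinarith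
    have hα1 : α < N := by nlinarith
    have hα2 : 0 < N - α := sub_pos.2 hα1
    have hβ2 : 0 < 1 - β := sub_pos.2 hβ1
    refine ⟨K * ((1 ^ (N - α) / (N - α)) * (2 * (π ^ (1 - β) / (1 - β)))), by positivity,
      fun ρ hρ hρ1 => ?_⟩
    have hδ : 0 < 1 - ρ := by linarith
    have h := lintegral_kernel_ofReal_le (N := N) hα hβ hρ hρ1
    rw [hab] at h hKdef
    rw [← hKdef] at h
    calc _ ≤ _ := h
      _ ≤ ENNReal.ofReal K * (ENNReal.ofReal (1 ^ (N - α) / (N - α)) *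
          (2 * ENNReal.ofReal (π ^ (1 - β) / (1 - β)))) := by
          gcongr
          · exact lintegral_rpow_mul_add_rpow_le_of_lt hα hα1 zero_le_one hδ
          · exact lintegral_rpow_mul_add_rpow_le_of_lt hβ hβ1 Real.pi_pos.le hδ
      _ = ENNReal.ofReal (K * ((1 ^ (N - α) / (N - α)) * (2 * (π ^ (1 - β) / (1 - β))))) := by
          rw [← ENNReal.ofReal_ofNat 2, ← ENNReal.ofReal_mul zero_le_two,
            ← ENNReal.ofReal_mul (by positivity), ← ENNReal.ofReal_mul (by positivity)]
      _ ≤ _ := by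
          refine ENNReal.ofReal_le_ofReal (le_mul_of_one_le_right (by positivity) ?_)
          have : 0 ≤ (1 - ρ) ^ (N + 1 - a) := by positivity
          linarith
  · have hβ1 : 1 < β := by by_contra! h; nlinarith
    have hα1 : N < α := by nlinarith
    have hα2 : 0 < α - N := sub_pos.2 hα1
    have hβ2 : 0 < β - 1 := sub_pos.2 hβ1
    refine ⟨K * ((1 / N + 1 / (α - N)) * (2 * (1 / 1 + 1 / (β - 1)))), by positivity,
      fun ρ hρ hρ1 => ?_⟩
    have hδ : 0 < 1 - ρ := by linarith
    have h := lintegral_kernel_ofReal_le (N := N) hα hβ hρ hρ1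
    rw [hab] at h hKdef
    rw [← hKdef] at h
    calc _ ≤ _ := h
      _ ≤ ENNReal.ofReal K * (ENNReal.ofReal ((1 / N + 1 / (α - N)) * (1 - ρ) ^ (N - α)) *
          (2 * ENNReal.ofReal ((1 / 1 + 1 / (β - 1)) * (1 - ρ) ^ (1 - β)))) := by
          gcongr
          · exact lintegral_rpow_mul_add_rpow_le_of_gt hN hα1 hδ
          · exact lintegral_rpow_mul_add_rpow_le_of_gt one_pos hβ1 hδ
      _ = ENNReal.ofReal (K * ((1 / N + 1 / (α - N)) * (2 * (1 / 1 + 1 / (β - 1)))) *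
          (1 - ρ) ^ (N + 1 - a)) := by
          rw [← ENNReal.ofReal_ofNat 2, ← ENNReal.ofReal_mul zero_le_two,
            ← ENNReal.ofReal_mul (by positivity), ← ENNReal.ofReal_mul (by positivity)]
          have : (1 - ρ) ^ (N + 1 - a) = (1 - ρ) ^ (N - α) * (1 - ρ) ^ (1 - β) := by
            rw [← Real.rpow_add hδ, ← hab]; ring_nf
          rw [this]
          congr 1
          ring
      _ ≤ _ := by
          gcongr
          linarith

lemma lintegral_kernel_eq_norm (N a : ℝ) (z : ℂ) :
    ∫⁻ w in Metric.ball (0 : ℂ) 1, ENNReal.ofReal ((1 - ‖w‖ ^ 2) ^ (N - 1) *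
        ‖1 - z * (starRingEnd ℂ) w‖ ^ (-a)) =
      ∫⁻ w in Metric.ball (0 : ℂ) 1, ENNReal.ofReal ((1 - ‖w‖ ^ 2) ^ (N - 1) *
        ‖1 - (‖z‖ : ℂ) * (starRingEnd ℂ) w‖ ^ (-a)) := by
  set ζ : Circle := Circle.exp (Complex.arg z)
  have hz : z = ‖z‖ * (ζ : ℂ) := by
    rw [Circle.coe_exp, Complex.norm_mul_exp_arg_mul_I]
  have hζ : (ζ : ℂ) * (starRingEnd ℂ) ζ = 1 := by
    rw [Complex.mul_conj, Complex.normSq_eq_norm_sq, Circle.norm_coe]; simp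
  have h := (rotation ζ).measurePreserving.setLIntegral_comp_preimage_emb
    (rotation ζ).toHomeomorph.measurableEmbedding
    (fun w => ENNReal.ofReal ((1 - ‖w‖ ^ 2) ^ (N - 1) * ‖1 - z * (starRingEnd ℂ) w‖ ^ (-a)))
    (Metric.ball 0 1)
  rw [← h]
  have hball : rotation ζ ⁻¹' Metric.ball 0 1 = Metric.ball 0 1 := by
    rw [LinearIsometryEquiv.preimage_ball, map_zero]
  rw [hball]
  refine lintegral_congr fun w => ?_
  have hmul : z * (starRingEnd ℂ) (rotation ζ w) = ‖z‖ * (starRingEnd ℂ) w := by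
    rw [rotation_apply, map_mul]
    linear_combination (starRingEnd ℂ) ζ * (starRingEnd ℂ) w * hz +
      ‖z‖ * (starRingEnd ℂ) w * hζ
  simp only [hmul, LinearIsometryEquiv.norm_map]

lemma one_sub_norm_le_norm_one_sub_mul_conj {z w : ℂ} (hw : ‖w‖ ≤ 1) :
    1 - ‖z‖ ≤ ‖1 - z * (starRingEnd ℂ) w‖ := by
  have h := norm_sub_norm_le (1 : ℂ) (z * (starRingEnd ℂ) w)
  rw [norm_one, norm_mul, RCLike.norm_conj] at h
  nlinarith [norm_nonneg z]

lemma norm_one_sub_mul_conj_le_two {z w : ℂ} (hz : ‖z‖ ≤ 1) (hw : ‖w‖ ≤ 1) :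
    ‖1 - z * (starRingEnd ℂ) w‖ ≤ 2 := by
  have h := norm_sub_le (1 : ℂ) (z * (starRingEnd ℂ) w)
  rw [norm_one, norm_mul, RCLike.norm_conj] at h
  nlinarith [norm_nonneg z, norm_nonneg w]

/-- The upper Forelli–Rudin estimate on the disk. -/
lemma exists_lintegral_kernel_le {N a : ℝ} (hN : 0 < N) (haN : a ≠ N + 1) :
    ∃ C : ℝ, 0 < C ∧ ∀ z ∈ Metric.ball (0 : ℂ) 1,
      ∫⁻ w in Metric.ball (0 : ℂ) 1, ENNReal.ofReal ((1 - ‖w‖ ^ 2) ^ (N - 1) *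
        ‖1 - z * (starRingEnd ℂ) w‖ ^ (-a)) ≤
      ENNReal.ofReal (C * (1 + (1 - ‖z‖) ^ (N + 1 - a))) := by
  rcases le_or_gt 0 a with ha | ha
  · obtain ⟨C, hC, h⟩ := exists_lintegral_kernel_ofReal_le hN ha haN
    refine ⟨C, hC, fun z hz => ?_⟩
    rw [lintegral_kernel_eq_norm]
    exact h _ (norm_nonneg z) (mem_ball_zero_iff.1 hz)
  · obtain ⟨C, hC, h⟩ := exists_lintegral_kernel_ofReal_le hN le_rfl (by linarith : (0 : ℝ) ≠ N + 1)
    refine ⟨2 ^ (-a) * (C * 2), by positivity, fun z hz => ?_⟩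
    have hz1 : ‖z‖ < 1 := mem_ball_zero_iff.1 hz
    have hδ : 0 < 1 - ‖z‖ := by linarith
    have hz0 := norm_nonneg z
    calc _ ≤ ∫⁻ w in Metric.ball (0 : ℂ) 1, ENNReal.ofReal (2 ^ (-a)) *
          ENNReal.ofReal ((1 - ‖w‖ ^ 2) ^ (N - 1) *
            ‖1 - (‖z‖ : ℂ) * (starRingEnd ℂ) w‖ ^ (-(0 : ℝ))) := by
          refine setLIntegral_mono' Metric.isOpen_ball.measurableSet fun w hw => ?_
          have hw1 : ‖w‖ < 1 := mem_ball_zero_iff.1 hw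
          have hw2 : 0 < 1 - ‖w‖ ^ 2 := by nlinarith [norm_nonneg w]
          rw [neg_zero, Real.rpow_zero, mul_one, ← ENNReal.ofReal_mul (by positivity),
            mul_comm (2 ^ (-a))]
          gcongr
          · linarith
          · exact norm_one_sub_mul_conj_le_two hz1.le hw1.le
      _ ≤ ENNReal.ofReal (2 ^ (-a)) *
          ENNReal.ofReal (C * (1 + (1 - ‖z‖) ^ (N + 1 - 0))) := by
          rw [lintegral_const_mul' _ _ ENNReal.ofReal_ne_top]
          gcongr
          exact h _ hz0 hz1
      _ ≤ _ := by
          rw [← ENNReal.ofReal_mul (by positivity), mul_assoc, mul_assoc]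
          have h1 : (1 - ‖z‖) ^ (N + 1 - 0) ≤ 1 :=
            Real.rpow_le_one hδ.le (by linarith) (by linarith)
          have h2 : 0 ≤ (1 - ‖z‖) ^ (N + 1 - a) := by positivity
          gcongr ENNReal.ofReal (_ * (_ * ?_))
          linarith

lemma setLIntegral_ball_rpow_norm_sub_le {q R : ℝ} (hq : q < 2) (hR : 0 ≤ R) (z : ℂ) :
    ∫⁻ w in Metric.ball z R, ENNReal.ofReal (‖w - z‖ ^ (-q)) ≤
      ENNReal.ofReal (R ^ (2 - q) / (2 - q)) * ENNReal.ofReal (2 * π) := by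
  have h := (measurePreserving_sub_right (volume : Measure ℂ) z).setLIntegral_comp_preimage_emb
    (Homeomorph.subRight z).measurableEmbedding
    (fun w => ENNReal.ofReal (‖w‖ ^ (-q))) (Metric.ball 0 R)
  have hball : (fun w => w - z) ⁻¹' Metric.ball 0 R = Metric.ball z R := by
    ext w; simp [dist_eq_norm]
  rw [hball] at h
  rw [h]
  have hpol := setLIntegral_ball_le_of_polar (F := fun w => ENNReal.ofReal (‖w‖ ^ (-q)))
    (G := fun r => ENNReal.ofReal (r ^ (2 - q - 1))) (H := fun _ => 1) (R := R)
    (by fun_prop) (by fun_prop) fun r hr θ _ => by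
      have hr0 := hr.1
      rw [← Complex.polarCoord_symm_apply (r, θ), Complex.norm_polarCoord_symm, abs_of_pos hr0,
        ← ENNReal.ofReal_mul hr0.le, mul_one]
      refine ENNReal.ofReal_le_ofReal (le_of_eq ?_)
      rw [show 2 - q - 1 = 1 + -q by ring, Real.rpow_add hr0, Real.rpow_one]
  refine hpol.trans (le_of_eq ?_)
  rw [lintegral_Ioo_rpow (by linarith) hR, setLIntegral_one, Real.volume_Ioo]
  ring_nf

lemma norm_sub_le_norm_one_sub_mul_conj {z w : ℂ} (hz : ‖z‖ ≤ 1) (hw : ‖w‖ ≤ 1) :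
    ‖w - z‖ ≤ ‖1 - z * (starRingEnd ℂ) w‖ := by
  refine le_of_abs_le (abs_le_of_sq_le_sq ?_ (norm_nonneg _))
  have hid : ‖1 - z * (starRingEnd ℂ) w‖ ^ 2 - ‖w - z‖ ^ 2 = (1 - ‖w‖ ^ 2) * (1 - ‖z‖ ^ 2) := by
    simp only [← Complex.normSq_eq_norm_sq, Complex.normSq_apply, Complex.sub_re, Complex.sub_im,
      Complex.mul_re, Complex.mul_im, Complex.conj_re, Complex.conj_im, Complex.one_re,
      Complex.one_im]
    ring
  have h1 : 0 ≤ 1 - ‖w‖ ^ 2 := by nlinarith [norm_nonneg w]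
  have h2 : 0 ≤ 1 - ‖z‖ ^ 2 := by nlinarith [norm_nonneg z]
  nlinarith [mul_nonneg h1 h2]

lemma norm_one_sub_mul_conj_le {z w : ℂ} (hz : ‖z‖ ≤ 1) :
    ‖1 - z * (starRingEnd ℂ) w‖ ≤ 2 * (1 - ‖z‖) + ‖w - z‖ := by
  have hid : 1 - z * (starRingEnd ℂ) w =
      ((1 - ‖z‖ ^ 2 : ℝ) : ℂ) - z * (starRingEnd ℂ) (w - z) := by
    have := Complex.mul_conj z
    rw [Complex.normSq_eq_norm_sq] at this
    push_cast at this ⊢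
    rw [map_sub]
    linear_combination -this
  have h0 := norm_nonneg z
  have h1 : 0 ≤ 1 - ‖z‖ ^ 2 := by nlinarith
  rw [hid]
  refine (norm_sub_le _ _).trans ?_
  rw [norm_mul, RCLike.norm_conj, Complex.norm_of_nonneg h1]
  nlinarith [norm_nonneg (w - z)]

lemma lintegral_near_le {q N M : ℝ} (hq : q < 2) (hM : 0 ≤ M) {z : ℂ} (hz : ‖z‖ < 1) :
    ∫⁻ w in Metric.ball z ((1 - ‖z‖) / 2), ENNReal.ofReal ((1 - ‖w‖ ^ 2) ^ (N - 1) /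
        (‖1 - z * (starRingEnd ℂ) w‖ ^ (1 + M) * ‖w - z‖ ^ q)) ≤
      ENNReal.ofReal (3 ^ |N - 1| * ((1 / 2) ^ (2 - q) / (2 - q) * (2 * π)) *
        (1 - ‖z‖) ^ (N - M - q)) := by
  set δ := 1 - ‖z‖ with hδdef
  have hδ : 0 < δ := by linarith
  have hz0 := norm_nonneg z
  have hq' : 0 < 2 - q := by linarith
  calc _ ≤ ∫⁻ w in Metric.ball z (δ / 2), ENNReal.ofReal (3 ^ |N - 1| * δ ^ (N - 1 - (1 + M))) *
        ENNReal.ofReal (‖w - z‖ ^ (-q)) := by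
        refine setLIntegral_mono' Metric.isOpen_ball.measurableSet fun w hw => ?_
        rw [mem_ball_iff_norm] at hw
        have hw1 : ‖w‖ ≤ ‖z‖ + ‖w - z‖ := by
          simpa using norm_add_le z (w - z)
        have hw2 : ‖z‖ ≤ ‖w‖ + ‖w - z‖ := by
          have := norm_sub_le w (w - z); simpa using this
        have hw0 := norm_nonneg w
        have hw3 : 0 < 1 - ‖w‖ ^ 2 := by nlinarith
        have hW : (1 - ‖w‖ ^ 2) ^ (N - 1) ≤ 3 ^ |N - 1| * δ ^ (N - 1) :=
          rpow_le_of_comparable _ three_pos hw3 hδ (by nlinarith) (by nlinarith)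
        have hX : δ ≤ ‖1 - z * (starRingEnd ℂ) w‖ :=
          one_sub_norm_le_norm_one_sub_mul_conj (by linarith)
        rw [← ENNReal.ofReal_mul (by positivity)]
        refine ENNReal.ofReal_le_ofReal ?_
        rw [div_mul_eq_div_div, div_eq_mul_inv _ (‖w - z‖ ^ q), ← Real.rpow_neg (norm_nonneg _),
          Real.rpow_sub hδ, ← mul_div_assoc]
        gcongr
    _ ≤ ENNReal.ofReal (3 ^ |N - 1| * δ ^ (N - 1 - (1 + M))) *
        (ENNReal.ofReal ((δ / 2) ^ (2 - q) / (2 - q)) * ENNReal.ofReal (2 * π)) := by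
        rw [lintegral_const_mul' _ _ ENNReal.ofReal_ne_top]
        gcongr
        exact setLIntegral_ball_rpow_norm_sub_le hq (by positivity) z
    _ = _ := by
        rw [← ENNReal.ofReal_mul (by positivity), ← ENNReal.ofReal_mul (by positivity)]
        congr 1
        rw [div_eq_mul_one_div δ 2, Real.mul_rpow hδ.le (by norm_num),
          show N - M - q = (N - 1 - (1 + M)) + (2 - q) by ring, Real.rpow_add hδ]
        ring

lemma far_integrand_le {q N M : ℝ} {z w : ℂ} (hz : ‖z‖ < 1) (hw : ‖w‖ < 1)
    (hzw : (1 - ‖z‖) / 2 ≤ ‖w - z‖) :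
    (1 - ‖w‖ ^ 2) ^ (N - 1) / (‖1 - z * (starRingEnd ℂ) w‖ ^ (1 + M) * ‖w - z‖ ^ q) ≤
      5 ^ |(-q)| * ((1 - ‖w‖ ^ 2) ^ (N - 1) *
        ‖1 - z * (starRingEnd ℂ) w‖ ^ (-(1 + M + q))) := by
  have hd : 0 < ‖w - z‖ := by linarith
  have hX1 := norm_sub_le_norm_one_sub_mul_conj hz.le hw.le
  have hX2 := norm_one_sub_mul_conj_le (w := w) hz.le
  set X := ‖1 - z * (starRingEnd ℂ) w‖
  have hX0 : 0 < X := by linarith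
  have hw3 : 0 < 1 - ‖w‖ ^ 2 := by nlinarith [norm_nonneg w]
  have hcomp : ‖w - z‖ ^ (-q) ≤ 5 ^ |(-q)| * X ^ (-q) :=
    rpow_le_of_comparable _ (by norm_num) hd hX0 (by linarith) (by linarith)
  calc _ = (1 - ‖w‖ ^ 2) ^ (N - 1) * X ^ (-(1 + M)) * ‖w - z‖ ^ (-q) := by
        rw [Real.rpow_neg hX0.le, Real.rpow_neg hd.le]; field_simp
    _ ≤ (1 - ‖w‖ ^ 2) ^ (N - 1) * X ^ (-(1 + M)) * (5 ^ |(-q)| * X ^ (-q)) := by gcongr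
    _ = _ := by
        rw [neg_add (1 + M) q, Real.rpow_add hX0]; ring

/-- the integral estimate of Lemma 2.3:
`∫_𝔻 (1-|w|²)^{N-1} / (|1-z·conj w|^{1+M} |w-z|^q) dν(w) ≲ 1 + (1-|z|²)^{N-M-q}`. -/
theorem statement10 (q N M : ℝ) (hq : q < 2) (hN : 0 < N) (hM : 0 ≤ M)
    (hNM : M ≠ N - q) :
    ∃ C : ℝ, 0 < C ∧
      ∀ z ∈ UD,
        (∫⁻ w, ENNReal.ofReal
            ((1 - ‖w‖ ^ 2) ^ (N - 1) /
              (‖1 - z * (starRingEnd ℂ) w‖ ^ (1 + M) * ‖w - z‖ ^ q)) ∂nuM)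
          ≤ ENNReal.ofReal (C * (1 + (1 - ‖z‖ ^ 2) ^ (N - M - q))) := by
  obtain ⟨C, hC, hker⟩ := exists_lintegral_kernel_le (N := N) (a := 1 + M + q) hN
    (fun h => hNM (by linarith))
  have hq' : 0 < 2 - q := by linarith
  set A : ℝ := 3 ^ |N - 1| * ((1 / 2) ^ (2 - q) / (2 - q) * (2 * π)) with hA
  set B : ℝ := 5 ^ |(-q)| * C with hB
  set e : ℝ := N - M - q with he
  have hA0 : 0 < A := by positivity
  have hB0 : 0 < B := by positivity
  refine ⟨π⁻¹ * ((A + B) * 2 ^ |e|), by positivity, fun z hz => ?_⟩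
  have hz1 : ‖z‖ < 1 := mem_ball_zero_iff.1 hz
  have hz0 := norm_nonneg z
  have hδ : 0 < 1 - ‖z‖ := by linarith
  have hd : 0 < 1 - ‖z‖ ^ 2 := by nlinarith
  rw [nuM, lintegral_smul_measure, smul_eq_mul, mul_assoc, ENNReal.ofReal_mul (by positivity)]
  gcongr
  set Φ : ℂ → ℝ≥0∞ := fun w => ENNReal.ofReal ((1 - ‖w‖ ^ 2) ^ (N - 1) /
    (‖1 - z * (starRingEnd ℂ) w‖ ^ (1 + M) * ‖w - z‖ ^ q))
  set S : Set ℂ := Metric.ball z ((1 - ‖z‖) / 2)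
  have hfar : ∫⁻ w in UD \ S, Φ w ≤ ENNReal.ofReal (B * (1 + (1 - ‖z‖) ^ e)) := by
    calc ∫⁻ w in UD \ S, Φ w ≤ ∫⁻ w in UD \ S, ENNReal.ofReal (5 ^ |(-q)|) *
          ENNReal.ofReal ((1 - ‖w‖ ^ 2) ^ (N - 1) *
            ‖1 - z * (starRingEnd ℂ) w‖ ^ (-(1 + M + q))) := by
          refine setLIntegral_mono'
            (Metric.isOpen_ball.measurableSet.diff Metric.isOpen_ball.measurableSet)
            fun w hw => ?_
          rw [← ENNReal.ofReal_mul (by positivity)]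
          refine ENNReal.ofReal_le_ofReal (far_integrand_le hz1 (mem_ball_zero_iff.1 hw.1) ?_)
          simpa [S, dist_eq_norm] using hw.2
      _ ≤ ENNReal.ofReal (5 ^ |(-q)|) *
          ENNReal.ofReal (C * (1 + (1 - ‖z‖) ^ (N + 1 - (1 + M + q)))) := by
          rw [lintegral_const_mul' _ _ ENNReal.ofReal_ne_top]
          gcongr
          exact (lintegral_mono_set sdiff_subset).trans (hker z hz)
      _ = _ := by
          rw [← ENNReal.ofReal_mul (by positivity), hB, he, mul_assoc]
          ring_nf
  have hcomp : (1 - ‖z‖) ^ e ≤ 2 ^ |e| * (1 - ‖z‖ ^ 2) ^ e :=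
    rpow_le_of_comparable e two_pos hδ hd (by nlinarith) (by nlinarith)
  have hone : (1 : ℝ) ≤ 2 ^ |e| := Real.one_le_rpow one_le_two (abs_nonneg e)
  calc ∫⁻ w in UD, Φ w ≤ ∫⁻ w in S ∪ UD \ S, Φ w :=
        lintegral_mono_set (by rw [union_sdiff_self]; exact subset_union_right)
    _ ≤ (∫⁻ w in S, Φ w) + ∫⁻ w in UD \ S, Φ w := lintegral_union_le _ _ _
    _ ≤ ENNReal.ofReal (A * (1 - ‖z‖) ^ e) + ENNReal.ofReal (B * (1 + (1 - ‖z‖) ^ e)) :=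
        add_le_add (lintegral_near_le hq hM hz1) hfar
    _ ≤ _ := by
        rw [← ENNReal.ofReal_add (by positivity) (by positivity)]
        refine ENNReal.ofReal_le_ofReal ?_
        have hx : 0 < (1 - ‖z‖) ^ e := by positivity
        calc A * (1 - ‖z‖) ^ e + B * (1 + (1 - ‖z‖) ^ e)
            ≤ (A + B) * (1 + (1 - ‖z‖) ^ e) := by nlinarith
          _ ≤ (A + B) * (2 ^ |e| * 1 + 2 ^ |e| * (1 - ‖z‖ ^ 2) ^ e) := by
              gcongr
              linarith
          _ = _ := by ring
end
end

section
/- Let δ ≥ 0 and let k be a positive integer. For all f, g holomorphic on an open neighborhood of the closed unit disk: if δ > 0, then δ·∫_𝔻 f(z)·conj(g(z))·(1−|z|²)^{δ−1} dν(z) = (δ+k)·∫_𝔻 f(z)·conj((R^k_{δ+1} g)(z))·(1−|z|²)^{δ+k−1} dν(z) = (δ+k)·∫_𝔻 (R^k_{δ+1} f)(z)·conj(g(z))·(1−|z|²)^{δ+k−1} dν(z); and if δ = 0, then ∫_{∂𝔻} f(ζ)·conj(g(ζ)) dσ(ζ) = k·∫_𝔻 f(z)·conj((R^k_{1} g)(z))·(1−|z|²)^{k−1}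 dν(z) = k·∫_𝔻 (R^k_{1} f)(z)·conj(g(z))·(1−|z|²)^{k−1} dν(z). -/
open MeasureTheory Filter Set Real Complex
open scoped ENNReal NNReal Topology

noncomputable section

theorem HolCl.hasDerivAt {f : ℂ → ℂ} (hf : HolCl f) {z : ℂ} (hz : z ∈ Metric.closedBall (0 : ℂ) 1) :
    HasDerivAt f (deriv f z) z := by
  obtain ⟨U, hU, hsub, hd⟩ := hf
  exact (hd.differentiableAt (hU.mem_nhds (hsub hz))).hasDerivAt

theorem HolCl.continuousOn {f : ℂ → ℂ} (hf : HolCl f) :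
    ContinuousOn f (Metric.closedBall 0 1) :=
  fun _ hz => (hf.hasDerivAt hz).continuousAt.continuousWithinAt

theorem HolCl.radial {f : ℂ → ℂ} (hf : HolCl f) : HolCl fun z => z * deriv f z := by
  obtain ⟨U, hU, hsub, hd⟩ := hf
  exact ⟨U, hU, hsub, differentiableOn_id.mul (hd.deriv hU)⟩

theorem HolCl.add_div_const {f g : ℂ → ℂ} (hf : HolCl f) (hg : HolCl g) (c : ℂ) :
    HolCl fun z => f z + g z / c := by
  obtain ⟨U, hU, hsub, hd⟩ := hf
  obtain ⟨V, hV, hsub', hd'⟩ := hg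
  exact ⟨U ∩ V, hU.inter hV, subset_inter hsub hsub',
    (hd.mono inter_subset_left).add ((hd'.mono inter_subset_right).div_const c)⟩

theorem HolCl.rkL {f : ℂ → ℂ} (hf : HolCl f) (L : ℝ) (k : ℕ) : HolCl (RkL L k f) := by
  induction k with
  | zero => exact hf
  | succ k ih => exact ih.add_div_const ih.radial _

/-- The point of `ℂ` with polar coordinates `(r, θ)`. -/
def polarPt (r θ : ℝ) : ℂ := r * Complex.exp (θ * Complex.I)

theorem norm_polarPt (r θ : ℝ) : ‖polarPt r θ‖ = |r| := by
  simp [polarPt, Complex.norm_exp_ofReal_mul_I]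

theorem polarPt_mem_closedBall {r : ℝ} (hr : r ∈ Icc (0 : ℝ) 1) (θ : ℝ) :
    polarPt r θ ∈ Metric.closedBall (0 : ℂ) 1 := by
  rw [mem_closedBall_zero_iff, norm_polarPt, abs_of_nonneg hr.1]
  exact hr.2

theorem continuous_polarPt : Continuous fun p : ℝ × ℝ => polarPt p.1 p.2 := by
  unfold polarPt
  fun_prop

theorem hasDerivAt_polarPt_radius (r θ : ℝ) :
    HasDerivAt (fun r => polarPt r θ) (Complex.exp (θ * Complex.I)) r := by
  simpa [polarPt] using (Complex.ofRealCLM.hasDerivAt (x := r)).mul_const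
    (Complex.exp (θ * Complex.I))

theorem hasDerivAt_polarPt_angle (r θ : ℝ) :
    HasDerivAt (fun θ => polarPt r θ) (polarPt r θ * Complex.I) θ := by
  have h : HasDerivAt (fun θ : ℝ => (θ : ℂ) * Complex.I) Complex.I θ := by
    simpa using (Complex.ofRealCLM.hasDerivAt (x := θ)).mul_const Complex.I
  simpa [polarPt, mul_assoc] using h.cexp.const_mul (r : ℂ)

theorem integral_nuM_radial_weight (Φ : ℂ → ℂ) (u : ℝ → ℝ) :
    ∫ z, Φ z * (u ‖z‖ : ℂ) ∂nuM = (π : ℂ)⁻¹ *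
      ∫ p in Ioo (0 : ℝ) 1 ×ˢ Ioo (-π) π,
        ((p.1 * u p.1 : ℝ) : ℂ) * Φ (polarPt p.1 p.2) := by
  have hpt (p : ℝ × ℝ) : Complex.polarCoord.symm p = polarPt p.1 p.2 := by
    rw [Complex.polarCoord_symm_apply, polarPt, Complex.exp_mul_I]
    simp
  have hvol : ∫ z in UD, Φ z * (u ‖z‖ : ℂ) =
      ∫ p in Ioo (0 : ℝ) 1 ×ˢ Ioo (-π) π,
        ((p.1 * u p.1 : ℝ) : ℂ) * Φ (polarPt p.1 p.2) := by
    rw [← integral_indicator (s := UD) Metric.isOpen_ball.measurableSet,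
      ← Complex.integral_comp_polarCoord_symm, polarCoord_target]
    rw [setIntegral_eq_of_subset_of_forall_sdiff_eq_zero (s := Ioo (0 : ℝ) 1 ×ˢ Ioo (-π) π)
      (measurableSet_Ioi.prod measurableSet_Ioo)
      (prod_mono Ioo_subset_Ioi_self Subset.rfl)]
    · refine setIntegral_congr_fun (measurableSet_Ioo.prod measurableSet_Ioo) fun p hp => ?_
      have h0 : 0 < p.1 := hp.1.1
      have h1 : p.1 < 1 := hp.1.2
      have hmem : polarPt p.1 p.2 ∈ UD := by
        rw [UD, mem_ball_zero_iff, norm_polarPt, abs_of_pos h0]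
        exact h1
      simp only [hpt, indicator_of_mem hmem, norm_polarPt, abs_of_pos h0, Complex.real_smul]
      push_cast
      ring
    · rintro p ⟨hp, hp'⟩
      have h0 : 0 < p.1 := hp.1
      have hmem : polarPt p.1 p.2 ∉ UD := by
        rw [UD, mem_ball_zero_iff, norm_polarPt, abs_of_pos h0]
        exact fun h1 => hp' ⟨⟨h0, h1⟩, hp.2⟩
      rw [hpt, indicator_of_notMem hmem, smul_zero]
  rw [nuM, integral_smul_measure, hvol, ENNReal.toReal_ofReal (by positivity), Complex.real_smul]
  push_cast
  rfl

theorem integrableOn_polar {Φ : ℂ → ℂ} (hΦ : ContinuousOn Φ (Metric.closedBall 0 1))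
    {v : ℝ → ℝ} (hv : IntegrableOn v (Ioc 0 1)) :
    IntegrableOn (fun p : ℝ × ℝ => (v p.1 : ℂ) * Φ (polarPt p.1 p.2))
      (Ioo (0 : ℝ) 1 ×ˢ Ioo (-π) π) := by
  refine IntegrableOn.mono_set (t := Icc (0 : ℝ) 1 ×ˢ Icc (-π) π) ?_
    (prod_mono Ioo_subset_Icc_self Ioo_subset_Icc_self)
  refine IntegrableOn.mul_continuousOn ?_ ?_ (isCompact_Icc.prod isCompact_Icc)
  · have hv' : IntegrableOn (fun r => (v r : ℂ)) (Icc 0 1) :=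
      ((integrableOn_Icc_iff_integrableOn_Ioc).2 hv).ofReal
    rw [IntegrableOn, Measure.volume_eq_prod, ← Measure.prod_restrict]
    exact Integrable.comp_fst hv' _
  · exact hΦ.comp continuous_polarPt.continuousOn
      fun p hp => polarPt_mem_closedBall hp.1 p.2

theorem integrableOn_weight_deriv {t : ℝ} (ht : 0 ≤ t) :
    IntegrableOn (fun r : ℝ => t * r * (1 - r ^ 2) ^ (t - 1)) (Ioc 0 1) := by
  refine intervalIntegral.integrableOn_deriv_of_nonneg
    (g := fun r : ℝ => -(1 - r ^ 2) ^ t / 2) ?_ ?_ ?_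
  · exact (((continuous_const.sub (continuous_pow 2)).rpow_const
      fun _ => Or.inr ht).neg.div_const 2).continuousOn
  · intro r hr
    have hpos : 0 < 1 - r ^ 2 := by nlinarith [hr.1, hr.2]
    have h1 : HasDerivAt (fun r : ℝ => 1 - r ^ 2) (-(2 * r)) r := by
      simpa using (hasDerivAt_pow 2 r).const_sub 1
    exact ((h1.rpow_const (p := t) (Or.inl hpos.ne')).neg.div_const 2).congr_deriv (by ring)
  · intro r hr
    have hpos : 0 < 1 - r ^ 2 := by nlinarith [hr.1, hr.2]
    have := hr.1
    positivity

theorem integrableOn_weight {t : ℝ} (ht : 0 ≤ t) :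
    IntegrableOn (fun r : ℝ => r * (1 - r ^ 2) ^ t) (Ioc 0 1) := by
  have : Continuous fun r : ℝ => r * (1 - r ^ 2) ^ t :=
    continuous_id.mul ((continuous_const.sub (continuous_pow 2)).rpow_const fun _ => Or.inr ht)
  exact (this.integrableOn_Icc).mono_set Ioc_subset_Icc_self

theorem integral_angle_radial_symm {F G : ℂ → ℂ} (hF : HolCl F) (hG : HolCl G) {r : ℝ}
    (hr : r ∈ Icc (0 : ℝ) 1) :
    ∫ θ in Ioo (-π) π, (polarPt r θ * deriv F (polarPt r θ)) *
        (starRingEnd ℂ) (G (polarPt r θ)) =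
      ∫ θ in Ioo (-π) π, F (polarPt r θ) *
        (starRingEnd ℂ) (polarPt r θ * deriv G (polarPt r θ)) := by
  have hcont {H : ℂ → ℂ} (hH : HolCl H) : Continuous fun θ : ℝ => H (polarPt r θ) :=
    hH.continuousOn.comp_continuous
      (continuous_polarPt.comp (by fun_prop : Continuous fun θ : ℝ => (r, θ)))
      (polarPt_mem_closedBall hr)
  have hder {H : ℂ → ℂ} (hH : HolCl H) (θ : ℝ) : HasDerivAt (fun θ : ℝ => H (polarPt r θ))
      (Complex.I * (polarPt r θ * deriv H (polarPt r θ))) θ :=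
    ((hH.hasDerivAt (polarPt_mem_closedBall hr θ)).comp θ
      (hasDerivAt_polarPt_angle r θ)).congr_deriv (by ring)
  have hc1 : Continuous fun θ : ℝ => (polarPt r θ * deriv F (polarPt r θ)) *
      (starRingEnd ℂ) (G (polarPt r θ)) :=
    (hcont hF.radial).mul (Complex.continuous_conj.comp (hcont hG))
  have hc2 : Continuous fun θ : ℝ => F (polarPt r θ) *
      (starRingEnd ℂ) (polarPt r θ * deriv G (polarPt r θ)) :=
    (hcont hF).mul (Complex.continuous_conj.comp (hcont hG.radial))
  have hπ : -π ≤ π := by linarith [Real.pi_pos]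
  have key := intervalIntegral.integral_eq_sub_of_hasDerivAt (a := -π) (b := π)
    (f := fun θ : ℝ => F (polarPt r θ) * (starRingEnd ℂ) (G (polarPt r θ)))
    (f' := fun θ : ℝ => Complex.I * ((polarPt r θ * deriv F (polarPt r θ)) *
        (starRingEnd ℂ) (G (polarPt r θ)) - F (polarPt r θ) *
        (starRingEnd ℂ) (polarPt r θ * deriv G (polarPt r θ))))
    (fun θ _ => ((hder hF θ).mul (hder hG θ).star).congr_deriv (by
      simp only [star_mul', Complex.star_def, Complex.conj_I, map_mul]
      ring))
    ((continuous_const.mul (hc1.sub hc2)).intervalIntegrable _ _)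
  have hper : polarPt r π = polarPt r (-π) := by
    simp [polarPt, Complex.exp_neg]
  rw [hper, sub_self, intervalIntegral.integral_const_mul, mul_eq_zero,
    or_iff_right Complex.I_ne_zero,
    intervalIntegral.integral_sub (hc1.intervalIntegrable _ _) (hc2.intervalIntegrable _ _),
    sub_eq_zero] at key
  simpa only [intervalIntegral.integral_of_le hπ, integral_Ioc_eq_integral_Ioo] using key

theorem integral_radius_deriv {F G : ℂ → ℂ} (hF : HolCl F) (hG : HolCl G) {t : ℝ} (ht : 0 ≤ t)
    (θ : ℝ) :
    ∫ r in Ioo (0 : ℝ) 1,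
      ((2 + 2 * (t : ℂ)) * (((r * (1 - r ^ 2) ^ t : ℝ) : ℂ) *
          (F (polarPt r θ) * (starRingEnd ℂ) (G (polarPt r θ)))) +
        (((r * (1 - r ^ 2) ^ t : ℝ) : ℂ) *
            (polarPt r θ * deriv F (polarPt r θ) * (starRingEnd ℂ) (G (polarPt r θ))) +
          ((r * (1 - r ^ 2) ^ t : ℝ) : ℂ) *
            (F (polarPt r θ) * (starRingEnd ℂ) (polarPt r θ * deriv G (polarPt r θ)))) -
        2 * (((t * r * (1 - r ^ 2) ^ (t - 1) : ℝ) : ℂ) *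
          (F (polarPt r θ) * (starRingEnd ℂ) (G (polarPt r θ))))) =
      (((0 : ℝ) ^ t : ℝ) : ℂ) * (F (polarPt 1 θ) * (starRingEnd ℂ) (G (polarPt 1 θ))) := by
  have hcont {H : ℂ → ℂ} (hH : HolCl H) :
      ContinuousOn (fun r : ℝ => H (polarPt r θ)) (Icc 0 1) :=
    hH.continuousOn.comp
      (continuous_polarPt.comp (by fun_prop : Continuous fun r : ℝ => (r, θ))).continuousOn
      fun r hr => polarPt_mem_closedBall hr θ
  have hprod {H K : ℂ → ℂ} (hH : HolCl H) (hK : HolCl K) : ContinuousOn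
      (fun r : ℝ => H (polarPt r θ) * (starRingEnd ℂ) (K (polarPt r θ))) (Icc 0 1) :=
    (hcont hH).mul (Complex.continuous_conj.comp_continuousOn (hcont hK))
  have hder {H : ℂ → ℂ} (hH : HolCl H) {r : ℝ} (hr : r ∈ Icc (0 : ℝ) 1) :
      HasDerivAt (fun r : ℝ => H (polarPt r θ))
        (deriv H (polarPt r θ) * Complex.exp (θ * Complex.I)) r :=
    (hH.hasDerivAt (polarPt_mem_closedBall hr θ)).comp r (hasDerivAt_polarPt_radius r θ)
  have hw : Continuous fun r : ℝ => r ^ 2 * (1 - r ^ 2) ^ t :=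
    (continuous_pow 2).mul
      ((continuous_const.sub (continuous_pow 2)).rpow_const fun _ => Or.inr ht)
  have hint {v : ℝ → ℝ} (hv : IntegrableOn v (Ioc 0 1)) {h : ℝ → ℂ}
      (hh : ContinuousOn h (Icc 0 1)) : IntegrableOn (fun r => (v r : ℂ) * h r) (Ioc 0 1) :=
    (IntegrableOn.mul_continuousOn
      ((integrableOn_Icc_iff_integrableOn_Ioc).2 hv).ofReal hh isCompact_Icc).mono_set
      Ioc_subset_Icc_self
  rw [← integral_Ioc_eq_integral_Ioo, ← intervalIntegral.integral_of_le zero_le_one]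
  rw [intervalIntegral.integral_eq_sub_of_hasDerivAt_of_le zero_le_one (f := fun r : ℝ =>
    ((r ^ 2 * (1 - r ^ 2) ^ t : ℝ) : ℂ) *
      (F (polarPt r θ) * (starRingEnd ℂ) (G (polarPt r θ))))]
  · simp
  · exact (Complex.continuous_ofReal.comp hw).continuousOn.mul (hprod hF hG)
  · intro r hr
    have hr' : r ∈ Icc (0 : ℝ) 1 := Ioo_subset_Icc_self hr
    have hpos : 0 < 1 - r ^ 2 := by nlinarith [hr.1, hr.2]
    have h1 : HasDerivAt (fun r : ℝ => 1 - r ^ 2) (-(2 * r)) r := by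
      simpa using (hasDerivAt_pow 2 r).const_sub 1
    have h2 : HasDerivAt (fun r : ℝ => r ^ 2) (2 * r) r := by
      simpa using hasDerivAt_pow 2 r
    have h3 := (h2.mul (h1.rpow_const (p := t) (Or.inl hpos.ne'))).ofReal_comp
    have h4 := h3.mul ((hder hF hr').mul (hder hG hr').star)
    refine h4.congr_deriv ?_
    have hpow : (1 - r ^ 2) ^ t = (1 - r ^ 2) ^ (t - 1) * (1 - r ^ 2) := by
      rw [← Real.rpow_add_one hpos.ne', sub_add_cancel]
    simp only [Complex.star_def, map_mul, polarPt, Complex.conj_ofReal, Pi.mul_apply, hpow]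
    push_cast
    ring
  · rw [intervalIntegrable_iff_integrableOn_Ioc_of_le zero_le_one]
    have hA := hint (integrableOn_weight ht) (hprod hF hG)
    have hB := hint (integrableOn_weight ht) (hprod hF.radial hG)
    have hC := hint (integrableOn_weight ht) (hprod hF hG.radial)
    have hD := hint (integrableOn_weight_deriv ht) (hprod hF hG)
    exact ((hA.const_mul (2 + 2 * (t : ℂ))).add (hB.add hC)).sub (hD.const_mul 2)

/-- The pairing `t ∫ f ḡ (1-|z|²)^{t-1} dν`. -/
def diskPairing (t : ℝ) (f g : ℂ → ℂ) : ℂ :=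
  (t : ℂ) * ∫ z, f z * (starRingEnd ℂ) (g z) * (((1 - ‖z‖ ^ 2) ^ (t - 1) : ℝ) : ℂ) ∂nuM

/-- The pairing `∫ f ḡ dσ` over the unit circle. -/
def circlePairing (f g : ℂ → ℂ) : ℂ :=
  (2 * π)⁻¹ • ∫ x in (0 : ℝ)..(2 * π),
    f (Complex.exp (x * Complex.I)) * (starRingEnd ℂ) (g (Complex.exp (x * Complex.I)))

theorem conj_diskPairing (t : ℝ) (f g : ℂ → ℂ) :
    (starRingEnd ℂ) (diskPairing t f g) = diskPairing t g f := by
  simp only [diskPairing, map_mul, Complex.conj_ofReal, ← integral_conj, Complex.conj_conj]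
  simp only [mul_comm (g _)]

theorem conj_circlePairing (f g : ℂ → ℂ) :
    (starRingEnd ℂ) (circlePairing f g) = circlePairing g f := by
  simp only [circlePairing, Complex.real_smul, map_mul, Complex.conj_ofReal,
    ← intervalIntegral.intervalIntegral_conj, Complex.conj_conj]
  simp only [mul_comm (g _)]

theorem circlePairing_eq (f g : ℂ → ℂ) :
    circlePairing f g = (2 * (π : ℂ))⁻¹ *
      ∫ θ in Ioo (-π) π, f (polarPt 1 θ) * (starRingEnd ℂ) (g (polarPt 1 θ)) := by
  have hper : Function.Periodic (fun x : ℝ => f (Complex.exp (x * Complex.I)) *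
      (starRingEnd ℂ) (g (Complex.exp (x * Complex.I)))) (2 * π) := by
    intro x
    have : Complex.exp (((x + 2 * π : ℝ) : ℂ) * Complex.I) = Complex.exp (x * Complex.I) := by
      push_cast
      rw [add_mul, Complex.exp_periodic]
    simp only [this]
  have h := hper.intervalIntegral_add_eq 0 (-π)
  rw [zero_add, show -π + 2 * π = π by ring] at h
  rw [circlePairing, h, intervalIntegral.integral_of_le (by linarith [Real.pi_pos]),
    integral_Ioc_eq_integral_Ioo, Complex.real_smul]
  simp [polarPt]

theorem diskPairing_add_circlePairing {F G : ℂ → ℂ} (hF : HolCl F) (hG : HolCl G) {t : ℝ}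
    (ht : 0 ≤ t) :
    diskPairing t F G + (((0 : ℝ) ^ t : ℝ) : ℂ) * circlePairing F G =
      diskPairing (t + 1) F fun z => G z + z * deriv G z / ((t : ℂ) + 1) := by
  have ht1 : (t : ℂ) + 1 ≠ 0 := by exact_mod_cast (by linarith : t + 1 ≠ 0)
  have hprod {H K : ℂ → ℂ} (hH : HolCl H) (hK : HolCl K) : ContinuousOn
      (fun z => H z * (starRingEnd ℂ) (K z)) (Metric.closedBall 0 1) :=
    hH.continuousOn.mul (Complex.continuous_conj.comp_continuousOn hK.continuousOn)
  have hwt := integrableOn_weight ht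
  have hwd := integrableOn_weight_deriv ht
  -- The four integrals over the polar rectangle.
  have iA := integrableOn_polar (hprod hF hG) hwt
  have iB := integrableOn_polar (hprod hF.radial hG) hwt
  have iC := integrableOn_polar (hprod hF hG.radial) hwt
  have iD := integrableOn_polar (hprod hF hG) hwd
  set S : Set (ℝ × ℝ) := Ioo (0 : ℝ) 1 ×ˢ Ioo (-π) π with hS
  set A := ∫ p in S, ((p.1 * (1 - p.1 ^ 2) ^ t : ℝ) : ℂ) *
    (F (polarPt p.1 p.2) * (starRingEnd ℂ) (G (polarPt p.1 p.2))) with hA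
  set B := ∫ p in S, ((p.1 * (1 - p.1 ^ 2) ^ t : ℝ) : ℂ) *
    (polarPt p.1 p.2 * deriv F (polarPt p.1 p.2) *
      (starRingEnd ℂ) (G (polarPt p.1 p.2))) with hB
  set C := ∫ p in S, ((p.1 * (1 - p.1 ^ 2) ^ t : ℝ) : ℂ) *
    (F (polarPt p.1 p.2) *
      (starRingEnd ℂ) (polarPt p.1 p.2 * deriv G (polarPt p.1 p.2))) with hC
  set D := ∫ p in S, ((t * p.1 * (1 - p.1 ^ 2) ^ (t - 1) : ℝ) : ℂ) *
    (F (polarPt p.1 p.2) * (starRingEnd ℂ) (G (polarPt p.1 p.2))) with hD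
  have hBC : B = C := by
    rw [hB, hC, hS, Measure.volume_eq_prod, setIntegral_prod _ iB, setIntegral_prod _ iC]
    refine setIntegral_congr_fun measurableSet_Ioo fun r hr => ?_
    simp only [integral_const_mul]
    rw [integral_angle_radial_symm hF hG (Ioo_subset_Icc_self hr)]
  have hparts : (2 + 2 * (t : ℂ)) * A + (B + C) - 2 * D = (((0 : ℝ) ^ t : ℝ) : ℂ) *
      ∫ θ in Ioo (-π) π, F (polarPt 1 θ) * (starRingEnd ℂ) (G (polarPt 1 θ)) := by
    have iABC := (iA.const_mul (2 + 2 * (t : ℂ))).add (iB.add iC)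
    have iT := iABC.sub (iD.const_mul 2)
    have hsum := integral_sub iABC (iD.const_mul 2)
    have hsum' := integral_add (iA.const_mul (2 + 2 * (t : ℂ))) (iB.add iC)
    simp only [Pi.add_apply] at hsum hsum'
    rw [hsum', integral_add iB iC, integral_const_mul, integral_const_mul] at hsum
    rw [hS, Measure.volume_eq_prod, ← Measure.prod_restrict] at iT
    have hswap := integral_prod_symm _ iT
    rw [Measure.prod_restrict, ← Measure.volume_eq_prod, ← hS] at hswap
    simp only [Pi.add_apply, Pi.sub_apply] at hswap
    rw [← hsum, hswap, ← integral_const_mul]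
    exact integral_congr_ae (ae_of_all _ fun θ => integral_radius_deriv hF hG ht θ)
  have hL : diskPairing t F G = (π : ℂ)⁻¹ * D := by
    rw [diskPairing, integral_nuM_radial_weight (fun z => F z * (starRingEnd ℂ) (G z))
      (fun r => (1 - r ^ 2) ^ (t - 1)), mul_left_comm, ← integral_const_mul, hD]
    congr 2
    ext p
    push_cast
    ring
  have hR : diskPairing (t + 1) F (fun z => G z + z * deriv G z / ((t : ℂ) + 1)) =
      (π : ℂ)⁻¹ * ((t + 1) * A + C) := by
    rw [diskPairing, integral_nuM_radial_weight (fun z => F z *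
      (starRingEnd ℂ) (G z + z * deriv G z / ((t : ℂ) + 1)))
      (fun r => (1 - r ^ 2) ^ (t + 1 - 1)), mul_left_comm, ← integral_const_mul]
    have hsum := integral_add (iA.const_mul ((t : ℂ) + 1)) iC
    rw [integral_const_mul] at hsum
    rw [hA, hC, ← hsum]
    congr 2
    ext p
    simp only [add_sub_cancel_right, map_add, map_div₀, map_one, Complex.conj_ofReal]
    push_cast
    field_simp
  rw [hL, hR, circlePairing_eq]
  have hpi : (π : ℂ) ≠ 0 := by exact_mod_cast Real.pi_ne_zero
  rw [mul_left_comm, ← hparts, hBC]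
  field_simp
  ring

theorem diskPairing_rkL {f g : ℂ → ℂ} (hf : HolCl f) (hg : HolCl g) {δ : ℝ} (hδ : 0 ≤ δ)
    {k : ℕ} (hk : 0 < k) :
    diskPairing δ f g + (((0 : ℝ) ^ δ : ℝ) : ℂ) * circlePairing f g =
      diskPairing (δ + k) f (RkL (δ + 1) k g) := by
  have step (m : ℕ) : (fun z => RkL (δ + 1) m g z +
      z * deriv (RkL (δ + 1) m g) z / (((δ + m : ℝ) : ℂ) + 1)) = RkL (δ + 1) (m + 1) g := by
    ext z
    rw [RkL]
    push_cast
    rw [add_right_comm]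
  induction k, hk using Nat.le_induction with
  | base =>
    rw [diskPairing_add_circlePairing hf hg hδ]
    simp [RkL]
  | succ m hm ih =>
    have hpos : 0 < δ + m := by
      have : (0 : ℝ) < m := by exact_mod_cast hm
      linarith
    have h := diskPairing_add_circlePairing hf (hg.rkL (δ + 1) m) hpos.le
    rw [Real.zero_rpow hpos.ne', Complex.ofReal_zero, zero_mul, add_zero, step] at h
    rw [ih, h]
    push_cast
    rw [add_assoc]

/-- the integration-by-parts identities
`⟨f,g⟩_δ = ⟨f, R^k_{δ+1} g⟩_{δ+k} = ⟨R^k_{δ+1} f, g⟩_{δ+k}` for `f, g ∈ H(𝔻̄)`. -/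
theorem statement17 (δ : ℝ) (k : ℕ) (hδ : 0 ≤ δ) (hk : 0 < k) (f g : ℂ → ℂ)
    (hf : HolCl f) (hg : HolCl g) :
    (0 < δ →
      ((δ : ℂ) * ∫ z, f z * (starRingEnd ℂ) (g z) *
            (((1 - ‖z‖ ^ 2) ^ (δ - 1) : ℝ) : ℂ) ∂nuM
          = ((δ + k : ℝ) : ℂ) * ∫ z, f z * (starRingEnd ℂ) (RkL (δ + 1) k g z) *
              (((1 - ‖z‖ ^ 2) ^ (δ + k - 1) : ℝ) : ℂ) ∂nuM
        ∧ (δ : ℂ) * ∫ z, f z * (starRingEnd ℂ) (g z) *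
              (((1 - ‖z‖ ^ 2) ^ (δ - 1) : ℝ) : ℂ) ∂nuM
            = ((δ + k : ℝ) : ℂ) * ∫ z, RkL (δ + 1) k f z * (starRingEnd ℂ) (g z) *
                (((1 - ‖z‖ ^ 2) ^ (δ + k - 1) : ℝ) : ℂ) ∂nuM))
    ∧ (δ = 0 →
      (((2 * π)⁻¹ • ∫ x in (0:ℝ)..(2 * π),
            f (Complex.exp (x * Complex.I)) *
              (starRingEnd ℂ) (g (Complex.exp (x * Complex.I))))
          = (k : ℂ) * ∫ z, f z * (starRingEnd ℂ) (RkL 1 k g z) *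
              (((1 - ‖z‖ ^ 2) ^ ((k : ℝ) - 1) : ℝ) : ℂ) ∂nuM
        ∧ ((2 * π)⁻¹ • ∫ x in (0:ℝ)..(2 * π),
              f (Complex.exp (x * Complex.I)) *
                (starRingEnd ℂ) (g (Complex.exp (x * Complex.I))))
            = (k : ℂ) * ∫ z, RkL 1 k f z * (starRingEnd ℂ) (g z) *
                (((1 - ‖z‖ ^ 2) ^ ((k : ℝ) - 1) : ℝ) : ℂ) ∂nuM)) := by
  have h1 := diskPairing_rkL hf hg hδ hk
  have h2 := congrArg (starRingEnd ℂ) (diskPairing_rkL hg hf hδ hk)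
  simp only [map_add, map_mul, Complex.conj_ofReal, conj_diskPairing, conj_circlePairing] at h2
  constructor
  · intro hpos
    rw [Real.zero_rpow hpos.ne', Complex.ofReal_zero, zero_mul, add_zero] at h1 h2
    exact ⟨h1, h2⟩
  · rintro rfl
    have h0 : diskPairing 0 f g = 0 := by simp [diskPairing]
    rw [Real.rpow_zero, Complex.ofReal_one, one_mul, h0, zero_add, zero_add, zero_add] at h1 h2
    simpa only [diskPairing, circlePairing, Complex.ofReal_natCast] using And.intro h1 h2
end
end

section
/- Let t > 0, let b be holomorphic on 𝔻 with sup_{z∈𝔻} (1−|z|²)·|(1+R)b(z)| < ∞, let f be holomorphic on an open neighborhood of the closed unit disk, and let m ≥ 2 be an integer. Then for every z ∈ 𝔻, all four integrals below converge absolutely and: ∫_𝔻 (1+R)b(w)·conj(f′(w))·(1−|w|²)^{t+1} / ((1−z·conj(w))^{t+1}·(w−z)) dν(w) = −∫_𝔻 (1+R)b(w)·conj(f″(w))·(conj(w−z)/(w−z))·(1−|w|²)^{t+m}/(1−z·conj(w))^{t+m} dν(w) + (t+m)·∫_𝔻 (1+R)b(w)·conj(f′(w))·conj(w−z)·(1−|w|²)^{t+m−1}/(1−z·conj(w))^{t+m+1}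 dν(w) + Σ_{j=1}^{m−1} ∫_𝔻 (1+R)b(w)·conj(w·f′(w))·(1−|w|²)^{t+j}/(1−z·conj(w))^{t+j+1} dν(w), where all complex powers of (1−z·conj(w)) are principal branches. -/
open MeasureTheory Filter Set Real Complex
open scoped ENNReal NNReal Topology

noncomputable section

/-- `f` is real differentiable at `w` with `∂̄f(w) = d`. -/
def HasDbarAt (f : ℂ → ℂ) (d w : ℂ) : Prop :=
  ∃ L : ℂ →L[ℝ] ℂ, HasFDerivAt f L w ∧ L 1 + I * L I = 2 * d

namespace HasDbarAt

variable {f g : ℂ → ℂ} {d e w : ℂ}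

theorem of_differentiableAt (h : DifferentiableAt ℂ f w) : HasDbarAt f 0 w := by
  refine ⟨(fderiv ℂ f w).restrictScalars ℝ, h.hasFDerivAt.restrictScalars ℝ, ?_⟩
  have : fderiv ℂ f w I = I * fderiv ℂ f w 1 := by
    rw [← smul_eq_mul, ← map_smul, smul_eq_mul, mul_one]
  simp only [ContinuousLinearMap.coe_restrictScalars', this]
  linear_combination fderiv ℂ f w 1 * I_mul_I

theorem conj_of_hasDerivAt (h : HasDerivAt f d w) :
    HasDbarAt (fun w => (starRingEnd ℂ) (f w)) ((starRingEnd ℂ) d) w := by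
  have h1 := h.hasFDerivAt.restrictScalars ℝ
  have h2 := (conjCLE : ℂ →L[ℝ] ℂ).hasFDerivAt.comp w h1
  refine ⟨_, h2, ?_⟩
  simp only [ContinuousLinearMap.comp_apply, ContinuousLinearMap.coe_restrictScalars',
    ContinuousLinearMap.toSpanSingleton_apply, ContinuousLinearEquiv.coe_coe, conjCLE_apply,
    smul_eq_mul, map_mul, conj_I, map_one]
  linear_combination -(starRingEnd ℂ) d * I_mul_I

theorem mul (hf : HasDbarAt f d w) (hg : HasDbarAt g e w) :
    HasDbarAt (fun w => f w * g w) (d * g w + f w * e) w := by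
  obtain ⟨L, hL, hL'⟩ := hf
  obtain ⟨N, hN, hN'⟩ := hg
  refine ⟨_, hL.mul hN, ?_⟩
  simp only [add_apply, smul_apply, smul_eq_mul]
  linear_combination g w * hL' + f w * hN'

theorem add (hf : HasDbarAt f d w) (hg : HasDbarAt g e w) :
    HasDbarAt (fun w => f w + g w) (d + e) w := by
  obtain ⟨L, hL, hL'⟩ := hf
  obtain ⟨N, hN, hN'⟩ := hg
  refine ⟨_, hL.add hN, ?_⟩
  simp only [add_apply]
  linear_combination hL' + hN'

theorem congr_deriv (hf : HasDbarAt f d w) (h : d = e) : HasDbarAt f e w := h ▸ hf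

theorem congr_of_eventuallyEq (hf : HasDbarAt f d w) (h : g =ᶠ[𝓝 w] f) : HasDbarAt g d w := by
  obtain ⟨L, hL, hL'⟩ := hf
  exact ⟨L, hL.congr_of_eventuallyEq h, hL'⟩

theorem const_sub (c : ℂ) (hf : HasDbarAt f d w) : HasDbarAt (fun w => c - f w) (-d) w := by
  obtain ⟨L, hL, hL'⟩ := hf
  refine ⟨_, hL.const_sub c, ?_⟩
  simp only [neg_apply]
  linear_combination -hL'

theorem const_mul (c : ℂ) (hf : HasDbarAt f d w) : HasDbarAt (fun w => c * f w) (c * d) w := by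
  obtain ⟨L, hL, hL'⟩ := hf
  refine ⟨_, hL.const_mul c, ?_⟩
  simp only [smul_apply, smul_eq_mul]
  linear_combination c * hL'

theorem comp_hasDerivAt (hg : HasDerivAt g e (f w)) (hf : HasDbarAt f d w) :
    HasDbarAt (fun w => g (f w)) (e * d) w := by
  obtain ⟨L, hL, hL'⟩ := hf
  refine ⟨_, (hg.hasFDerivAt.restrictScalars ℝ).comp w hL, ?_⟩
  simp only [ContinuousLinearMap.comp_apply, ContinuousLinearMap.coe_restrictScalars',
    ContinuousLinearMap.toSpanSingleton_apply, smul_eq_mul]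
  linear_combination e * hL'

theorem conj_id : HasDbarAt (starRingEnd ℂ) 1 w := by
  simpa using! conj_of_hasDerivAt (hasDerivAt_id w)

end HasDbarAt

/-- Green's formula for functions vanishing outside the unit disk. -/
theorem integral_dbar_eq_zero {f d : ℂ → ℂ} (hf : ∀ w, HasDbarAt f (d w) w)
    (hf0 : ∀ w ∉ UD, f w = 0) (hd0 : ∀ w ∉ UD, d w = 0) (hd : Integrable d) :
    ∫ w, d w = 0 := by
  choose L hL hL' using hf
  have hbar : ∀ w, I • L w 1 - L w I = 2 * I * d w := fun w => by
    rw [smul_eq_mul]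
    linear_combination I * hL' w - L w I * I_mul_I
  have hre : ∀ w : ℂ, 1 ≤ |w.re| → f w = 0 := fun w h => hf0 w (by
    simpa [UD] using h.trans (abs_re_le_norm w))
  have him : ∀ w : ℂ, 1 ≤ |w.im| → f w = 0 := fun w h => hf0 w (by
    simpa [UD] using h.trans (abs_im_le_norm w))
  have hrect := integral_boundary_rect_of_hasFDerivAt_real_off_countable f L (-1 - I) (1 + I) ∅
    countable_empty (fun w _ => (hL w).continuousAt.continuousWithinAt) (fun w _ => hL w)
    (by simpa only [hbar] using (hd.const_mul (2 * I)).integrableOn)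
  have e1 : ∀ x : ℝ, f (x + (-1 - I).im * I) = 0 := fun x => him _ (by simp)
  have e2 : ∀ x : ℝ, f (x + (1 + I).im * I) = 0 := fun x => him _ (by simp)
  have e3 : ∀ x : ℝ, f ((1 + I).re + x * I) = 0 := fun x => hre _ (by simp)
  have e4 : ∀ x : ℝ, f ((-1 - I).re + x * I) = 0 := fun x => hre _ (by simp)
  have hre' : (-1 - I).re ≤ (1 + I).re := by norm_num
  have him' : (-1 - I).im ≤ (1 + I).im := by norm_num
  simp only [hbar, e1, e2, e3, e4, sub_self, intervalIntegral.integral_of_le hre',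
    intervalIntegral.integral_of_le him', integral_const_mul, integral_zero, smul_zero,
    add_zero] at hrect
  have hd' : Integrable (fun p : ℝ × ℝ => d (p.1 + p.2 * I)) := by
    have := (volume_preserving_equiv_real_prod.symm).integrable_comp_emb
      measurableEquivRealProd.symm.measurableEmbedding (g := d)
    simpa [Function.comp_def, measurableEquivRealProd_symm_apply, mk_eq_add_mul_I] using this.2 hd
  have hint : ∫ w, d w = ∫ p : ℝ × ℝ, d (p.1 + p.2 * I) := by
    rw [← (volume_preserving_equiv_real_prod.symm).integral_comp
      measurableEquivRealProd.symm.measurableEmbedding]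
    simp [measurableEquivRealProd_symm_apply, mk_eq_add_mul_I]
  have hset : ∫ p : ℝ × ℝ, d (p.1 + p.2 * I) =
      ∫ p in Ioc (-1 - I).re (1 + I).re ×ˢ Ioc (-1 - I).im (1 + I).im, d (p.1 + p.2 * I) := by
    refine (setIntegral_eq_integral_of_forall_compl_eq_zero fun p hp => hd0 _ fun h => hp ?_).symm
    have h1 : ‖(p.1 + p.2 * I : ℂ)‖ < 1 := by simpa [UD] using h
    have h2 := (abs_re_le_norm _).trans_lt h1
    have h3 := (abs_im_le_norm _).trans_lt h1
    simp only [add_re, add_im, ofReal_re, ofReal_im, re_ofReal_mul, im_ofReal_mul, I_re, I_im,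
      abs_lt] at h2 h3
    simp only [mem_prod, mem_Ioc, add_re, add_im, sub_re, sub_im, neg_re, neg_im, one_re, one_im,
      I_re, I_im]
    refine ⟨⟨?_, ?_⟩, ?_, ?_⟩ <;> linarith
  rw [hint, hset, Measure.volume_eq_prod, setIntegral_prod _ hd'.integrableOn]
  have h2I : (2 * I : ℂ) ≠ 0 := by simp
  exact (mul_eq_zero.1 hrect.symm).resolve_left h2I

theorem one_sub_norm_sq_pos {w : ℂ} (hw : w ∈ UD) : 0 < 1 - ‖w‖ ^ 2 := by
  have : ‖w‖ < 1 := by simpa [UD] using hw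
  nlinarith [norm_nonneg w]

theorem one_sub_norm_le_norm {z w : ℂ} (hw : w ∈ UD) :
    1 - ‖z‖ ≤ ‖1 - z * (starRingEnd ℂ) w‖ := by
  have hw' : ‖w‖ < 1 := by simpa [UD] using hw
  have h1 := norm_sub_norm_le (1 : ℂ) (z * (starRingEnd ℂ) w)
  rw [norm_one, norm_mul, RCLike.norm_conj] at h1
  nlinarith [norm_nonneg z]

theorem one_sub_mul_conj_mem_slitPlane {z w : ℂ} (hz : z ∈ UD) (hw : w ∈ UD) :
    1 - z * (starRingEnd ℂ) w ∈ slitPlane := by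
  have hz' : ‖z‖ < 1 := by simpa [UD] using hz
  have hw' : ‖w‖ < 1 := by simpa [UD] using hw
  left
  have h1 := re_le_norm (z * (starRingEnd ℂ) w)
  rw [norm_mul, RCLike.norm_conj] at h1
  rw [sub_re, one_re]
  nlinarith [norm_nonneg z, norm_nonneg w]

theorem ofReal_one_sub_norm_sq (w : ℂ) :
    ((1 - ‖w‖ ^ 2 : ℝ) : ℂ) = 1 - w * (starRingEnd ℂ) w := by
  rw [mul_conj, normSq_eq_norm_sq]
  push_cast
  rfl

/-- The `∂̄`-derivative of the regularized primitive, in which `1 / (w - z)` is replaced by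
`conj (w - z) / (|w - z|² + ε)`. -/
theorem hasDbarAt_regularized {G F : ℂ → ℂ} {z w : ℂ} {s ε : ℝ} (hz : z ∈ UD) (hw : w ∈ UD)
    (hε : 0 < ε) (hG : DifferentiableAt ℂ G w) (hF : DifferentiableAt ℂ F w) :
    HasDbarAt (fun w => G w * (starRingEnd ℂ) (F w) * (starRingEnd ℂ) (w - z) ^ 2 *
        (1 - w * (starRingEnd ℂ) w) ^ (s : ℂ) * (1 - z * (starRingEnd ℂ) w) ^ (-(s : ℂ)) *
        ((w - z) * (starRingEnd ℂ) (w - z) + ε)⁻¹)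
      (G w * (starRingEnd ℂ) (deriv F w) * ((starRingEnd ℂ) (w - z) / (w - z)) *
          (((1 - ‖w‖ ^ 2) ^ s : ℝ) : ℂ) / (1 - z * (starRingEnd ℂ) w) ^ (s : ℂ) *
          ((‖w - z‖ ^ 2 / (‖w - z‖ ^ 2 + ε) : ℝ) : ℂ)
        + G w * (starRingEnd ℂ) (F w) * (((1 - ‖w‖ ^ 2) ^ s : ℝ) : ℂ) /
          ((1 - z * (starRingEnd ℂ) w) ^ (s : ℂ) * (w - z)) *
          ((‖w - z‖ ^ 2 * (‖w - z‖ ^ 2 + 2 * ε) / (‖w - z‖ ^ 2 + ε) ^ 2 : ℝ) : ℂ)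
        - s * (G w * (starRingEnd ℂ) (F w) * (starRingEnd ℂ) (w - z) *
          (((1 - ‖w‖ ^ 2) ^ (s - 1) : ℝ) : ℂ) /
          (1 - z * (starRingEnd ℂ) w) ^ ((s + 1 : ℝ) : ℂ)) *
          ((‖w - z‖ ^ 2 / (‖w - z‖ ^ 2 + ε) : ℝ) : ℂ)) w := by
  have hUs : 1 - w * (starRingEnd ℂ) w ∈ slitPlane := one_sub_mul_conj_mem_slitPlane hw hw
  have hVs : 1 - z * (starRingEnd ℂ) w ∈ slitPlane := one_sub_mul_conj_mem_slitPlane hz hw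
  have hid : HasDbarAt (fun w : ℂ => w) 0 w := .of_differentiableAt differentiableAt_id
  have hU : HasDbarAt (fun w : ℂ => 1 - w * (starRingEnd ℂ) w) (-w) w :=
    ((hid.mul .conj_id).const_sub 1).congr_deriv (by ring)
  have hV : HasDbarAt (fun w : ℂ => 1 - z * (starRingEnd ℂ) w) (-z) w :=
    ((HasDbarAt.conj_id.const_mul z).const_sub 1).congr_deriv (by ring)
  have hQ : HasDbarAt (fun w : ℂ => w - z) 0 w :=
    .of_differentiableAt (differentiableAt_id.sub_const z)
  have hQc : HasDbarAt (fun w : ℂ => (starRingEnd ℂ) (w - z)) 1 w := by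
    simpa using! HasDbarAt.conj_of_hasDerivAt ((hasDerivAt_id w).sub_const z)
  have hQn : (w - z) * (starRingEnd ℂ) (w - z) = ((‖w - z‖ ^ 2 : ℝ) : ℂ) := by
    rw [mul_conj, normSq_eq_norm_sq]
  have hden : (w - z) * (starRingEnd ℂ) (w - z) + ε ≠ 0 := by
    rw [hQn, ← ofReal_add, ofReal_ne_zero]
    positivity
  have hE := HasDbarAt.comp_hasDerivAt (g := fun x => x⁻¹)
    (f := fun w => (w - z) * (starRingEnd ℂ) (w - z) + ε) (hasDerivAt_inv hden)
    ((hQ.mul hQc).add (.of_differentiableAt (differentiableAt_const (ε : ℂ))))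
  have hP := HasDbarAt.comp_hasDerivAt (g := fun x => x ^ (s : ℂ))
    (f := fun w => 1 - w * (starRingEnd ℂ) w) ((hasDerivAt_id _).cpow_const hUs) hU
  have hN := HasDbarAt.comp_hasDerivAt (g := fun x => x ^ (-(s : ℂ)))
    (f := fun w => 1 - z * (starRingEnd ℂ) w) ((hasDerivAt_id _).cpow_const hVs) hV
  have hQc2 := HasDbarAt.comp_hasDerivAt (g := fun x => x ^ 2)
    (f := fun w => (starRingEnd ℂ) (w - z)) (hasDerivAt_pow 2 _) hQc
  have hFc := HasDbarAt.conj_of_hasDerivAt hF.hasDerivAt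
  refine ((((((HasDbarAt.of_differentiableAt hG).mul hFc).mul hQc2).mul hP).mul hN).mul
    hE).congr_deriv ?_
  have hU0 := slitPlane_ne_zero hUs
  have hV0 := slitPlane_ne_zero hVs
  have hP1 : (1 - w * (starRingEnd ℂ) w) ^ (s : ℂ) =
      (1 - w * (starRingEnd ℂ) w) ^ ((s : ℂ) - 1) * (1 - w * (starRingEnd ℂ) w) := by
    rw [cpow_sub _ _ hU0, cpow_one]; field_simp
  have hN1 : (1 - z * (starRingEnd ℂ) w) ^ (-(s : ℂ)) =
      (1 - z * (starRingEnd ℂ) w) ^ (-(s : ℂ) - 1) * (1 - z * (starRingEnd ℂ) w) := by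
    rw [cpow_sub _ _ hV0, cpow_one]; field_simp
  have hVinv : ((1 - z * (starRingEnd ℂ) w) ^ (s : ℂ))⁻¹ =
      (1 - z * (starRingEnd ℂ) w) ^ (-(s : ℂ)) := (cpow_neg _ _).symm
  have hVinv' : ((1 - z * (starRingEnd ℂ) w) ^ ((s + 1 : ℝ) : ℂ))⁻¹ =
      (1 - z * (starRingEnd ℂ) w) ^ (-(s : ℂ) - 1) := by
    rw [← cpow_neg]; congr 1; push_cast; ring
  have hu := (one_sub_norm_sq_pos hw).le
  rw [ofReal_cpow hu, ofReal_cpow hu, ofReal_one_sub_norm_sq, ofReal_sub, ofReal_one]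
  simp only [id, div_eq_mul_inv, mul_inv, hVinv, hVinv']
  simp only [ofReal_mul, ofReal_inv, ofReal_add, ofReal_pow (_ + _) 2, ← hQn, ofReal_ofNat]
  rw [hN1, hP1]
  rcases eq_or_ne (w - z) 0 with h0 | h0
  · simp [h0]
  generalize hp : (1 - w * (starRingEnd ℂ) w) ^ ((s : ℂ) - 1) = p
  generalize hn : (1 - z * (starRingEnd ℂ) w) ^ (-(s : ℂ) - 1) = n
  generalize (starRingEnd ℂ) (w - z) = qc at hden ⊢
  field_simp
  ring

/-- A function dominated by `‖x - w‖ ^ p` near `w`, with `p > 1`, has zero derivative at `w`. -/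
theorem hasDbarAt_zero_of_norm_le {f : ℂ → ℂ} {w : ℂ} {K p : ℝ} (hp : 1 < p) (h0 : f w = 0)
    (h : ∀ x, ‖f x‖ ≤ K * ‖x - w‖ ^ p) : HasDbarAt f 0 w := by
  refine ⟨0, .of_isLittleO ?_, by simp⟩
  simp only [h0, sub_zero, zero_apply]
  have hO : f =O[𝓝 w] fun x => ‖x - w‖ ^ p := .of_bound K (.of_forall fun x => by
    rw [Real.norm_of_nonneg (by positivity)]
    exact h x)
  refine hO.trans_isLittleO ?_
  have ht : Tendsto (fun x : ℂ => ‖x - w‖ ^ (p - 1)) (𝓝 w) (𝓝 0) := by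
    have : Continuous fun x : ℂ => ‖x - w‖ ^ (p - 1) :=
      (continuous_id.sub continuous_const).norm.rpow_const fun _ => Or.inr (by linarith)
    simpa [Real.zero_rpow (by linarith : p - 1 ≠ 0)] using this.tendsto w
  have h2 := ((Asymptotics.isLittleO_one_iff ℝ).2 ht).mul_isBigO
    (Asymptotics.isBigO_refl (fun x : ℂ => ‖x - w‖) (𝓝 w))
  refine (Asymptotics.IsLittleO.of_norm_right (h2.congr (fun x => ?_) fun x => one_mul _))
  rcases eq_or_ne (‖x - w‖) 0 with h | h
  · simp [h, Real.zero_rpow (by linarith : p ≠ 0)]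
  · rw [← Real.rpow_add_one h, sub_add_cancel]

theorem norm_inv_cpow_le {z w : ℂ} {s : ℝ} (hs : 0 ≤ s) (hz : z ∈ UD) (hw : w ∈ UD) :
    ‖((1 - z * (starRingEnd ℂ) w) ^ (s : ℂ))⁻¹‖ ≤ ((1 - ‖z‖) ^ s)⁻¹ := by
  have hz' : 0 < 1 - ‖z‖ := by simpa [UD] using hz
  rw [norm_inv, norm_cpow_real]
  exact inv_anti₀ (by positivity) (Real.rpow_le_rpow hz'.le (one_sub_norm_le_norm hw) hs)

theorem norm_regularized_le {G F : ℂ → ℂ} {z w : ℂ} {s ε M C : ℝ} (hz : z ∈ UD) (hw : w ∈ UD)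
    (hε : 0 < ε) (hs : 0 ≤ s) (hG : (1 - ‖w‖ ^ 2) * ‖G w‖ ≤ M) (hF : ‖F w‖ ≤ C) :
    ‖G w * (starRingEnd ℂ) (F w) * (starRingEnd ℂ) (w - z) ^ 2 *
        (1 - w * (starRingEnd ℂ) w) ^ (s : ℂ) * (1 - z * (starRingEnd ℂ) w) ^ (-(s : ℂ)) *
        ((w - z) * (starRingEnd ℂ) (w - z) + ε)⁻¹‖ ≤
      M * C * ((1 - ‖z‖) ^ s)⁻¹ * (1 - ‖w‖ ^ 2) ^ (s - 1) := by
  have hu := one_sub_norm_sq_pos hw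
  have hz' : 0 < 1 - ‖z‖ := by simpa [UD] using hz
  have hC : 0 ≤ C := (norm_nonneg _).trans hF
  have hV := norm_inv_cpow_le hs hz hw
  have hden : (w - z) * (starRingEnd ℂ) (w - z) + ε = ((‖w - z‖ ^ 2 + ε : ℝ) : ℂ) := by
    rw [mul_conj, normSq_eq_norm_sq]
    push_cast
    rfl
  have hU : ‖(1 - w * (starRingEnd ℂ) w) ^ (s : ℂ)‖ = (1 - ‖w‖ ^ 2) ^ (s - 1) * (1 - ‖w‖ ^ 2) := by
    rw [norm_cpow_real, ← ofReal_one_sub_norm_sq, Complex.norm_of_nonneg hu.le,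
      ← Real.rpow_add_one hu.ne', sub_add_cancel]
  have hq : ‖w - z‖ ^ 2 * (‖w - z‖ ^ 2 + ε)⁻¹ ≤ 1 := by
    rw [← div_eq_mul_inv, div_le_one (by positivity)]
    linarith
  rw [cpow_neg, hden]
  simp only [norm_mul, norm_pow, RCLike.norm_conj, hU]
  rw [norm_inv (ofReal _), Complex.norm_of_nonneg (r := ‖w - z‖ ^ 2 + ε) (by positivity)]
  calc _ = (((1 - ‖w‖ ^ 2) * ‖G w‖) * ‖F w‖ * ‖((1 - z * (starRingEnd ℂ) w) ^ (s : ℂ))⁻¹‖ *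
        (1 - ‖w‖ ^ 2) ^ (s - 1)) * (‖w - z‖ ^ 2 * (‖w - z‖ ^ 2 + ε)⁻¹) := by ring
    _ ≤ (((1 - ‖w‖ ^ 2) * ‖G w‖) * ‖F w‖ * ‖((1 - z * (starRingEnd ℂ) w) ^ (s : ℂ))⁻¹‖ *
        (1 - ‖w‖ ^ 2) ^ (s - 1)) := mul_le_of_le_one_right (by positivity) hq
    _ ≤ _ := by
      have hM : 0 ≤ M := le_trans (by positivity) hG
      gcongr

theorem one_sub_norm_sq_le {w x : ℂ} (hw : w ∈ UD) (hx : x ∉ UD) :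
    1 - ‖w‖ ^ 2 ≤ 2 * ‖w - x‖ := by
  have hw' : ‖w‖ < 1 := by simpa [UD] using hw
  have hx' : 1 ≤ ‖x‖ := by simpa [UD] using hx
  have := norm_sub_norm_le x w
  rw [norm_sub_rev] at this
  nlinarith [norm_nonneg w]

theorem integrable_nuM_iff {f : ℂ → ℂ} : Integrable f nuM ↔ IntegrableOn f UD :=
  integrable_smul_measure (by simp [Real.pi_pos]) ENNReal.ofReal_ne_top

theorem integral_nuM (f : ℂ → ℂ) : ∫ w, f w ∂nuM = (π⁻¹ : ℝ) • ∫ w in UD, f w := by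
  rw [nuM, integral_smul_measure, ENNReal.toReal_ofReal (by positivity)]

theorem ae_nuM_mem : ∀ᵐ w ∂nuM, w ∈ UD :=
  Measure.ae_smul_measure (ae_restrict_mem Metric.isOpen_ball.measurableSet) _

theorem ae_nuM_ne (z : ℂ) : ∀ᵐ w ∂nuM, w ≠ z :=
  Measure.ae_smul_measure (ae_restrict_of_ae (Measure.ae_ne volume z)) _

/-- Removal of the regularization of the singularity at `z`. -/
theorem integral_eq_of_regularized {A B D : ℂ → ℂ} {z s : ℂ} (hA : Integrable A nuM)
    (hB : Integrable B nuM) (hD : Integrable D nuM)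
    (h : ∀ ε : ℝ, 0 < ε →
      Integrable (fun w => A w * ((‖w - z‖ ^ 2 / (‖w - z‖ ^ 2 + ε) : ℝ) : ℂ) +
        B w * ((‖w - z‖ ^ 2 * (‖w - z‖ ^ 2 + 2 * ε) / (‖w - z‖ ^ 2 + ε) ^ 2 : ℝ) : ℂ) -
        s * D w * ((‖w - z‖ ^ 2 / (‖w - z‖ ^ 2 + ε) : ℝ) : ℂ)) nuM →
      ∫ w, (A w * ((‖w - z‖ ^ 2 / (‖w - z‖ ^ 2 + ε) : ℝ) : ℂ) +
        B w * ((‖w - z‖ ^ 2 * (‖w - z‖ ^ 2 + 2 * ε) / (‖w - z‖ ^ 2 + ε) ^ 2 : ℝ) : ℂ) -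
        s * D w * ((‖w - z‖ ^ 2 / (‖w - z‖ ^ 2 + ε) : ℝ) : ℂ)) ∂nuM = 0) :
    ∫ w, B w ∂nuM = -(∫ w, A w ∂nuM) + s * ∫ w, D w ∂nuM := by
  have hα : ∀ ε : ℝ, 0 < ε → ∀ w : ℂ,
      ‖((‖w - z‖ ^ 2 / (‖w - z‖ ^ 2 + ε) : ℝ) : ℂ)‖ ≤ 1 := fun ε hε w => by
    rw [Complex.norm_of_nonneg (by positivity)]
    exact div_le_one_of_le₀ (by linarith) (by positivity)
  have hβ : ∀ ε : ℝ, 0 < ε → ∀ w : ℂ,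
      ‖((‖w - z‖ ^ 2 * (‖w - z‖ ^ 2 + 2 * ε) / (‖w - z‖ ^ 2 + ε) ^ 2 : ℝ) : ℂ)‖ ≤ 1 := by
    intro ε hε w
    rw [Complex.norm_of_nonneg (by positivity)]
    exact div_le_one_of_le₀ (by nlinarith) (by positivity)
  set T : ℝ → ℂ → ℂ := fun ε w => A w * ((‖w - z‖ ^ 2 / (‖w - z‖ ^ 2 + ε) : ℝ) : ℂ) +
    B w * ((‖w - z‖ ^ 2 * (‖w - z‖ ^ 2 + 2 * ε) / (‖w - z‖ ^ 2 + ε) ^ 2 : ℝ) : ℂ) -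
    s * D w * ((‖w - z‖ ^ 2 / (‖w - z‖ ^ 2 + ε) : ℝ) : ℂ) with hT
  have hmeas : ∀ ε, AEStronglyMeasurable (T ε) nuM := fun ε => by
    refine ((hA.1.mul ?_).add (hB.1.mul ?_)).sub ((hD.1.const_mul s).mul ?_) <;>
    exact Measurable.aestronglyMeasurable (by fun_prop)
  have hbd : Integrable (fun w => ‖A w‖ + ‖B w‖ + ‖s * D w‖) nuM :=
    (hA.norm.add hB.norm).add (hD.const_mul s).norm
  have hle : ∀ ε, 0 < ε → ∀ w, ‖T ε w‖ ≤ ‖A w‖ + ‖B w‖ + ‖s * D w‖ := fun ε hε w => by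
    refine (norm_sub_le _ _).trans (add_le_add ((norm_add_le _ _).trans (add_le_add ?_ ?_)) ?_) <;>
    rw [norm_mul]
    · exact mul_le_of_le_one_right (norm_nonneg _) (hα ε hε w)
    · exact mul_le_of_le_one_right (norm_nonneg _) (hβ ε hε w)
    · exact mul_le_of_le_one_right (norm_nonneg _) (hα ε hε w)
  have hlim : Tendsto (fun ε => ∫ w, T ε w ∂nuM) (𝓝[>] 0)
      (𝓝 (∫ w, (A w + B w - s * D w) ∂nuM)) := by
    refine tendsto_integral_filter_of_dominated_convergence _ (.of_forall hmeas)
      (eventually_mem_nhdsWithin.mono fun ε hε => .of_forall (hle ε hε)) hbd ?_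
    filter_upwards [ae_nuM_ne z] with w hw
    have hw' : ‖w - z‖ ^ 2 ≠ 0 := by simpa [sub_eq_zero] using hw
    have hc : ContinuousAt (fun ε => T ε w) 0 := by
      have h1 : ContinuousAt (fun ε : ℝ => ‖w - z‖ ^ 2 / (‖w - z‖ ^ 2 + ε)) 0 :=
        ContinuousAt.div (by fun_prop) (by fun_prop) (by simpa using hw')
      have h2 : ContinuousAt (fun ε : ℝ =>
          ‖w - z‖ ^ 2 * (‖w - z‖ ^ 2 + 2 * ε) / (‖w - z‖ ^ 2 + ε) ^ 2) 0 :=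
        ContinuousAt.div (by fun_prop) (by fun_prop) (by simpa using hw')
      have h1' := continuous_ofReal.continuousAt.comp h1
      have h2' := continuous_ofReal.continuousAt.comp h2
      exact ((continuousAt_const.mul h1').add (continuousAt_const.mul h2')).sub
        (continuousAt_const.mul h1')
    have h0 : T 0 w = A w + B w - s * D w := by
      simp only [hT, mul_zero, add_zero, ← sq, div_self hw', div_self (pow_ne_zero 2 hw'),
        ofReal_one, mul_one]
    rw [← h0]
    exact hc.tendsto.mono_left nhdsWithin_le_nhds
  have hzero : ∫ w, (A w + B w - s * D w) ∂nuM = 0 := by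
    refine tendsto_nhds_unique hlim (tendsto_const_nhds.congr' ?_)
    refine eventually_mem_nhdsWithin.mono fun ε hε => (h ε hε ?_).symm
    exact hbd.mono' (hmeas ε) (.of_forall (hle ε hε))
  rw [integral_sub (f := fun w => A w + B w) (hA.add hB) (hD.const_mul s), integral_add hA hB,
    integral_const_mul] at hzero
  linear_combination hzero

/-- Integration by parts against the modified Cauchy kernel `(1-|w|²)^s / ((1-z w̄)^s (w-z))`. -/
theorem integral_modified_cauchy_kernel {G F : ℂ → ℂ} {z : ℂ} {s M C : ℝ} (hz : z ∈ UD)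
    (hs : 2 < s) (hG : DifferentiableOn ℂ G UD) (hF : DifferentiableOn ℂ F UD)
    (hGM : ∀ w ∈ UD, (1 - ‖w‖ ^ 2) * ‖G w‖ ≤ M) (hFC : ∀ w ∈ UD, ‖F w‖ ≤ C)
    (hA : Integrable (fun w => G w * (starRingEnd ℂ) (deriv F w) *
      ((starRingEnd ℂ) (w - z) / (w - z)) * (((1 - ‖w‖ ^ 2) ^ s : ℝ) : ℂ) /
      (1 - z * (starRingEnd ℂ) w) ^ (s : ℂ)) nuM)
    (hB : Integrable (fun w => G w * (starRingEnd ℂ) (F w) * (((1 - ‖w‖ ^ 2) ^ s : ℝ) : ℂ) /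
      ((1 - z * (starRingEnd ℂ) w) ^ (s : ℂ) * (w - z))) nuM)
    (hD : Integrable (fun w => G w * (starRingEnd ℂ) (F w) * (starRingEnd ℂ) (w - z) *
      (((1 - ‖w‖ ^ 2) ^ (s - 1) : ℝ) : ℂ) / (1 - z * (starRingEnd ℂ) w) ^ ((s + 1 : ℝ) : ℂ)) nuM) :
    ∫ w, G w * (starRingEnd ℂ) (F w) * (((1 - ‖w‖ ^ 2) ^ s : ℝ) : ℂ) /
        ((1 - z * (starRingEnd ℂ) w) ^ (s : ℂ) * (w - z)) ∂nuM =
      -(∫ w, G w * (starRingEnd ℂ) (deriv F w) *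
        ((starRingEnd ℂ) (w - z) / (w - z)) * (((1 - ‖w‖ ^ 2) ^ s : ℝ) : ℂ) /
        (1 - z * (starRingEnd ℂ) w) ^ (s : ℂ) ∂nuM) +
      s * ∫ w, G w * (starRingEnd ℂ) (F w) * (starRingEnd ℂ) (w - z) *
        (((1 - ‖w‖ ^ 2) ^ (s - 1) : ℝ) : ℂ) /
        (1 - z * (starRingEnd ℂ) w) ^ ((s + 1 : ℝ) : ℂ) ∂nuM := by
  have hopen : IsOpen UD := Metric.isOpen_ball
  refine integral_eq_of_regularized (z := z) hA hB hD fun ε hε hint => ?_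
  rw [integral_nuM, ← integral_indicator hopen.measurableSet,
    integral_dbar_eq_zero (f := UD.indicator fun w => G w * (starRingEnd ℂ) (F w) *
      (starRingEnd ℂ) (w - z) ^ 2 * (1 - w * (starRingEnd ℂ) w) ^ (s : ℂ) *
      (1 - z * (starRingEnd ℂ) w) ^ (-(s : ℂ)) * ((w - z) * (starRingEnd ℂ) (w - z) + ε)⁻¹)
      (fun w => ?_) (fun w hw => indicator_of_notMem hw _) (fun w hw => indicator_of_notMem hw _)
      ((integrable_indicator_iff hopen.measurableSet).2 (integrable_nuM_iff.1 hint)), smul_zero]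
  by_cases hw : w ∈ UD
  · rw [indicator_of_mem hw]
    exact (hasDbarAt_regularized (s := s) hz hw hε (hG.differentiableAt (hopen.mem_nhds hw))
      (hF.differentiableAt (hopen.mem_nhds hw))).congr_of_eventuallyEq
        (eqOn_indicator.eventuallyEq_of_mem (hopen.mem_nhds hw))
  · rw [indicator_of_notMem hw]
    have hC : 0 ≤ C := (norm_nonneg _).trans (hFC z hz)
    have hM : 0 ≤ M := (mul_nonneg (one_sub_norm_sq_pos hz).le (norm_nonneg _)).trans (hGM z hz)
    have hz' : 0 < 1 - ‖z‖ := by simpa [UD] using hz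
    refine hasDbarAt_zero_of_norm_le (K := M * C * ((1 - ‖z‖) ^ s)⁻¹ * 2 ^ (s - 1)) (p := s - 1)
      (by linarith) (indicator_of_notMem hw _) fun x => ?_
    by_cases hx : x ∈ UD
    · rw [indicator_of_mem hx]
      refine (norm_regularized_le (s := s) hz hx hε (by linarith) (hGM x hx) (hFC x hx)).trans ?_
      rw [mul_assoc _ (2 ^ (s - 1)), ← Real.mul_rpow (by norm_num) (norm_nonneg _)]
      gcongr
      · exact (one_sub_norm_sq_pos hx).le
      · linarith
      · exact one_sub_norm_sq_le hx hw
    · rw [indicator_of_notMem hx, norm_zero]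
      positivity

theorem integrable_inv_norm_sub (z : ℂ) : Integrable (fun w : ℂ => (‖w - z‖⁻¹ : ℝ)) nuM := by
  have h : LocallyIntegrable (fun x : ℂ => (‖x‖⁻¹ : ℝ)) := by
    refine locallyIntegrable_of_norm_le_rpow (C := 1) (α := 1) (by simp) (by simp)
      (.of_forall fun x => ?_) (Measurable.aestronglyMeasurable (by fun_prop))
    rw [Real.rpow_neg_one, one_mul, norm_inv, norm_norm]
  have h1 : IntegrableOn (fun x : ℂ => (‖x‖⁻¹ : ℝ)) (Metric.closedBall (-z) 1) :=
    h.integrableOn_isCompact (isCompact_closedBall _ _)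
  have h2 := (measurePreserving_sub_right volume z).integrableOn_comp_preimage
    (MeasurableEquiv.subRight z).measurableEmbedding (f := fun x : ℂ => (‖x‖⁻¹ : ℝ))
    (s := Metric.closedBall (-z) 1)
  refine (integrable_smul_measure (by simp [Real.pi_pos]) ENNReal.ofReal_ne_top).2
    ((h2.2 h1).mono_set fun w hw => ?_)
  have : ‖w‖ < 1 := by simpa [UD] using hw
  simpa [dist_eq_norm] using this.le

/-- Functions `G · conj F · k` are integrable when `k` is small enough at the boundary to
compensate the growth of `G`, and has at most a Cauchy-type singularity. -/
theorem integrable_mul_conj_mul {G F k : ℂ → ℂ} {z : ℂ} {M C K : ℝ} (hG : ContinuousOn G UD)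
    (hF : ContinuousOn F UD) (hk : Measurable k)
    (hGM : ∀ w ∈ UD, (1 - ‖w‖ ^ 2) * ‖G w‖ ≤ M) (hFC : ∀ w ∈ UD, ‖F w‖ ≤ C)
    (hkK : ∀ w ∈ UD, w ≠ z → ‖k w‖ ≤ K * (1 - ‖w‖ ^ 2) * ‖w - z‖⁻¹) :
    Integrable (fun w => G w * (starRingEnd ℂ) (F w) * k w) nuM := by
  have hopen : IsOpen UD := Metric.isOpen_ball
  have hGF : ContinuousOn (fun w => G w * (starRingEnd ℂ) (F w)) UD :=
    hG.mul (continuous_conj.comp_continuousOn hF)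
  have hmeas : AEStronglyMeasurable (fun w => G w * (starRingEnd ℂ) (F w)) nuM :=
    (hGF.aestronglyMeasurable hopen.measurableSet).smul_measure _
  refine ((integrable_inv_norm_sub z).const_mul (M * C * |K|)).mono'
    (hmeas.mul hk.aestronglyMeasurable) ?_
  filter_upwards [ae_nuM_mem, ae_nuM_ne z] with w hw hwz
  have hu := one_sub_norm_sq_pos hw
  have hC : 0 ≤ C := (norm_nonneg _).trans (hFC w hw)
  have hM : 0 ≤ M := (mul_nonneg hu.le (norm_nonneg _)).trans (hGM w hw)
  rw [norm_mul, norm_mul, RCLike.norm_conj]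
  calc ‖G w‖ * ‖F w‖ * ‖k w‖ ≤ ‖G w‖ * ‖F w‖ * (|K| * (1 - ‖w‖ ^ 2) * ‖w - z‖⁻¹) := by
        gcongr
        refine (hkK w hw hwz).trans ?_
        gcongr
        exact le_abs_self K
    _ = ((1 - ‖w‖ ^ 2) * ‖G w‖) * ‖F w‖ * |K| * ‖w - z‖⁻¹ := by ring
    _ ≤ _ := by
        have := hGM w hw
        have := hFC w hw
        gcongr

theorem norm_one_sub_rpow_le {w : ℂ} {p : ℝ} (hp : 1 ≤ p) (hw : w ∈ UD) :
    ‖(((1 - ‖w‖ ^ 2) ^ p : ℝ) : ℂ)‖ ≤ 1 - ‖w‖ ^ 2 := by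
  have hu := one_sub_norm_sq_pos hw
  rw [Complex.norm_of_nonneg (by positivity)]
  exact Real.rpow_le_self_of_le_one hu.le (by nlinarith [norm_nonneg w]) hp

theorem norm_sub_le_two {z w : ℂ} (hz : z ∈ UD) (hw : w ∈ UD) : ‖w - z‖ ≤ 2 := by
  have hw' : ‖w‖ < 1 := by simpa [UD] using hw
  have hz' : ‖z‖ < 1 := by simpa [UD] using hz
  linarith [norm_sub_le w z]

section Kernels

variable {G F : ℂ → ℂ} {z : ℂ} {M C p s : ℝ}

theorem integrable_bounded_kernel {l : ℂ → ℂ} {L : ℝ} (hz : z ∈ UD) (hp : 1 ≤ p) (hs : 0 ≤ s)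
    (hG : ContinuousOn G UD) (hF : ContinuousOn F UD) (hl : Measurable l)
    (hGM : ∀ w ∈ UD, (1 - ‖w‖ ^ 2) * ‖G w‖ ≤ M) (hFC : ∀ w ∈ UD, ‖F w‖ ≤ C)
    (hlL : ∀ w ∈ UD, w ≠ z → ‖l w‖ ≤ L * ‖w - z‖⁻¹) :
    Integrable (fun w => G w * (starRingEnd ℂ) (F w) * (l w * (((1 - ‖w‖ ^ 2) ^ p : ℝ) : ℂ) *
      ((1 - z * (starRingEnd ℂ) w) ^ (s : ℂ))⁻¹)) nuM := by
  refine integrable_mul_conj_mul (z := z) (K := L * ((1 - ‖z‖) ^ s)⁻¹) hG hF ?_ hGM hFC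
    fun w hw hwz => ?_
  · exact (hl.mul (by fun_prop)).mul (by fun_prop)
  · have h1 := hlL w hw hwz
    have h2 := norm_one_sub_rpow_le hp hw
    have h3 := norm_inv_cpow_le hs hz hw
    have h4 := (one_sub_norm_sq_pos hw).le
    rw [norm_mul, norm_mul]
    calc _ ≤ L * ‖w - z‖⁻¹ * (1 - ‖w‖ ^ 2) * ((1 - ‖z‖) ^ s)⁻¹ := by
          have := (norm_nonneg _).trans h1
          gcongr
      _ = _ := by ring

theorem integrable_cauchy_kernel (hz : z ∈ UD) (hp : 1 ≤ p) (hs : 0 ≤ s)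
    (hG : ContinuousOn G UD) (hF : ContinuousOn F UD)
    (hGM : ∀ w ∈ UD, (1 - ‖w‖ ^ 2) * ‖G w‖ ≤ M) (hFC : ∀ w ∈ UD, ‖F w‖ ≤ C) :
    Integrable (fun w => G w * (starRingEnd ℂ) (F w) * (((1 - ‖w‖ ^ 2) ^ p : ℝ) : ℂ) /
      ((1 - z * (starRingEnd ℂ) w) ^ (s : ℂ) * (w - z))) nuM := by
  refine (integrable_bounded_kernel (l := fun w => (w - z)⁻¹) (L := 1) hz hp hs hG hF
    (by fun_prop) hGM hFC fun w hw _ => by rw [norm_inv, one_mul]).congr (.of_forall fun w => ?_)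
  simp only [div_eq_mul_inv, mul_inv]
  ring

theorem integrable_phase_kernel (hz : z ∈ UD) (hp : 1 ≤ p) (hs : 0 ≤ s)
    (hG : ContinuousOn G UD) (hF : ContinuousOn F UD)
    (hGM : ∀ w ∈ UD, (1 - ‖w‖ ^ 2) * ‖G w‖ ≤ M) (hFC : ∀ w ∈ UD, ‖F w‖ ≤ C) :
    Integrable (fun w => G w * (starRingEnd ℂ) (F w) * ((starRingEnd ℂ) (w - z) / (w - z)) *
      (((1 - ‖w‖ ^ 2) ^ p : ℝ) : ℂ) / (1 - z * (starRingEnd ℂ) w) ^ (s : ℂ)) nuM := by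
  refine (integrable_bounded_kernel (l := fun w => (starRingEnd ℂ) (w - z) / (w - z)) (L := 2)
    hz hp hs hG hF (by fun_prop) hGM hFC fun w hw _ => ?_).congr (.of_forall fun w => ?_)
  · rw [norm_div, RCLike.norm_conj, div_eq_mul_inv]
    gcongr
    exact norm_sub_le_two hz hw
  · simp only [div_eq_mul_inv]
    ring

theorem integrable_conj_sub_kernel (hz : z ∈ UD) (hp : 1 ≤ p) (hs : 0 ≤ s)
    (hG : ContinuousOn G UD) (hF : ContinuousOn F UD)
    (hGM : ∀ w ∈ UD, (1 - ‖w‖ ^ 2) * ‖G w‖ ≤ M) (hFC : ∀ w ∈ UD, ‖F w‖ ≤ C) :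
    Integrable (fun w => G w * (starRingEnd ℂ) (F w) * (starRingEnd ℂ) (w - z) *
      (((1 - ‖w‖ ^ 2) ^ p : ℝ) : ℂ) / (1 - z * (starRingEnd ℂ) w) ^ (s : ℂ)) nuM := by
  refine (integrable_bounded_kernel (l := fun w => (starRingEnd ℂ) (w - z)) (L := 4)
    hz hp hs hG hF (by fun_prop) hGM hFC fun w hw hwz => ?_).congr (.of_forall fun w => ?_)
  · have h : 0 < ‖w - z‖ := norm_pos_iff.2 (sub_ne_zero.2 hwz)
    rw [RCLike.norm_conj, ← div_eq_mul_inv, le_div_iff₀ h]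
    nlinarith [norm_sub_le_two hz hw]
  · simp only [div_eq_mul_inv]
    ring

theorem integrable_radial_kernel (hz : z ∈ UD) (hp : 1 ≤ p) (hs : 0 ≤ s)
    (hG : ContinuousOn G UD) (hF : ContinuousOn F UD)
    (hGM : ∀ w ∈ UD, (1 - ‖w‖ ^ 2) * ‖G w‖ ≤ M) (hFC : ∀ w ∈ UD, ‖F w‖ ≤ C) :
    Integrable (fun w => G w * (starRingEnd ℂ) (w * F w) *
      (((1 - ‖w‖ ^ 2) ^ p : ℝ) : ℂ) / (1 - z * (starRingEnd ℂ) w) ^ (s : ℂ)) nuM := by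
  refine (integrable_bounded_kernel (l := fun w => (starRingEnd ℂ) w) (L := 2)
    hz hp hs hG hF (by fun_prop) hGM hFC fun w hw hwz => ?_).congr (.of_forall fun w => ?_)
  · have h : 0 < ‖w - z‖ := norm_pos_iff.2 (sub_ne_zero.2 hwz)
    have hw' : ‖w‖ < 1 := by simpa [UD] using hw
    rw [RCLike.norm_conj, ← div_eq_mul_inv, le_div_iff₀ h]
    nlinarith [norm_sub_le_two hz hw, norm_nonneg w]
  · simp only [div_eq_mul_inv, map_mul]
    ring

end Kernels

/-- The geometric expansion of the Cauchy kernel coming from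
`(1 - z w̄) - (1 - |w|²) = w̄ (w - z)`. -/
theorem cauchy_kernel_expansion {z w : ℂ} {t : ℝ} (hz : z ∈ UD) (hw : w ∈ UD) (hwz : w ≠ z)
    (n : ℕ) :
    (((1 - ‖w‖ ^ 2) ^ (t + 1) : ℝ) : ℂ) /
        ((1 - z * (starRingEnd ℂ) w) ^ ((t + 1 : ℝ) : ℂ) * (w - z)) =
      (((1 - ‖w‖ ^ 2) ^ (t + (n + 1 : ℕ)) : ℝ) : ℂ) /
        ((1 - z * (starRingEnd ℂ) w) ^ ((t + (n + 1 : ℕ) : ℝ) : ℂ) * (w - z)) +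
      ∑ j ∈ Finset.Icc 1 n, (starRingEnd ℂ) w * (((1 - ‖w‖ ^ 2) ^ (t + j) : ℝ) : ℂ) /
        (1 - z * (starRingEnd ℂ) w) ^ ((t + j + 1 : ℝ) : ℂ) := by
  have hu := one_sub_norm_sq_pos hw
  have hV0 := slitPlane_ne_zero (one_sub_mul_conj_mem_slitPlane hz hw)
  have hq : w - z ≠ 0 := sub_ne_zero.2 hwz
  induction n with
  | zero => simp
  | succ n ih =>
    rw [ih, Finset.sum_Icc_succ_top (by omega), add_comm (Finset.sum _ _), ← add_assoc]
    congr 1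
    have e1 : t + (n + 1 + 1 : ℕ) = t + (n + 1 : ℕ) + 1 := by push_cast; ring
    rw [e1]
    generalize t + (n + 1 : ℕ) = r
    have hVr : (1 - z * (starRingEnd ℂ) w) ^ (r : ℂ) ≠ 0 := by simp [cpow_eq_zero_iff, hV0]
    rw [Real.rpow_add_one hu.ne', ofReal_mul, ofReal_one_sub_norm_sq, ofReal_add, ofReal_one,
      cpow_add _ _ hV0, cpow_one]
    field_simp
    ring

theorem HolCl.deriv {f : ℂ → ℂ} (hf : HolCl f) : HolCl (deriv f) := by
  obtain ⟨U, hU, hsub, hd⟩ := hf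
  exact ⟨U, hU, hsub, hd.deriv hU⟩

theorem HolCl.differentiableOn {f : ℂ → ℂ} (hf : HolCl f) : DifferentiableOn ℂ f UD := by
  obtain ⟨U, hU, hsub, hd⟩ := hf
  exact hd.mono (Metric.ball_subset_closedBall.trans hsub)

theorem HolCl.exists_norm_le {f : ℂ → ℂ} (hf : HolCl f) : ∃ C : ℝ, ∀ w ∈ UD, ‖f w‖ ≤ C := by
  obtain ⟨U, hU, hsub, hd⟩ := hf
  obtain ⟨C, hC⟩ := (isCompact_closedBall (0 : ℂ) 1).exists_bound_of_continuousOn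
    (hd.continuousOn.mono hsub)
  exact ⟨C, fun w hw => hC w (Metric.ball_subset_closedBall hw)⟩

/-- the modified Cauchy–Pompeiu decomposition
`𝒦^{t+1}((1+R)b ∂̄f) = 𝒦^{t+m}_0((1+R)b ∂̄²f) + 𝒦^{t+m-1}_1((1+R)b ∂̄f)
  + Σ_{j=1}^{m-1} Q^{t+j}((1+R)b conj(Rf))`. -/
theorem statement18 (t : ℝ) (ht : 0 < t) (b f : ℂ → ℂ)
    (hb : DifferentiableOn ℂ b UD)
    (hbB : ∃ M : ℝ, ∀ z ∈ UD, (1 - ‖z‖ ^ 2) * ‖opR b z‖ ≤ M)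
    (hf : HolCl f) (m : ℕ) (hm : 2 ≤ m) :
    ∀ z ∈ UD,
      Integrable (fun w => opR b w * (starRingEnd ℂ) (deriv f w) *
          (((1 - ‖w‖ ^ 2) ^ (t + 1) : ℝ) : ℂ) /
          ((1 - z * (starRingEnd ℂ) w) ^ ((t + 1 : ℝ) : ℂ) * (w - z))) nuM
      ∧ Integrable (fun w => opR b w * (starRingEnd ℂ) (deriv (deriv f) w) *
          ((starRingEnd ℂ) (w - z) / (w - z)) *
          (((1 - ‖w‖ ^ 2) ^ (t + m) : ℝ) : ℂ) /
          (1 - z * (starRingEnd ℂ) w) ^ ((t + m : ℝ) : ℂ)) nuM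
      ∧ Integrable (fun w => opR b w * (starRingEnd ℂ) (deriv f w) *
          (starRingEnd ℂ) (w - z) *
          (((1 - ‖w‖ ^ 2) ^ (t + m - 1) : ℝ) : ℂ) /
          (1 - z * (starRingEnd ℂ) w) ^ ((t + m + 1 : ℝ) : ℂ)) nuM
      ∧ (∀ j ∈ Finset.Icc 1 (m - 1),
          Integrable (fun w => opR b w * (starRingEnd ℂ) (w * deriv f w) *
            (((1 - ‖w‖ ^ 2) ^ (t + j) : ℝ) : ℂ) /
            (1 - z * (starRingEnd ℂ) w) ^ ((t + j + 1 : ℝ) : ℂ)) nuM)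
      ∧ (∫ w, opR b w * (starRingEnd ℂ) (deriv f w) *
            (((1 - ‖w‖ ^ 2) ^ (t + 1) : ℝ) : ℂ) /
            ((1 - z * (starRingEnd ℂ) w) ^ ((t + 1 : ℝ) : ℂ) * (w - z)) ∂nuM)
          = -(∫ w, opR b w * (starRingEnd ℂ) (deriv (deriv f) w) *
                ((starRingEnd ℂ) (w - z) / (w - z)) *
                (((1 - ‖w‖ ^ 2) ^ (t + m) : ℝ) : ℂ) /
                (1 - z * (starRingEnd ℂ) w) ^ ((t + m : ℝ) : ℂ) ∂nuM)
            + ((t + m : ℝ) : ℂ) *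
                (∫ w, opR b w * (starRingEnd ℂ) (deriv f w) *
                  (starRingEnd ℂ) (w - z) *
                  (((1 - ‖w‖ ^ 2) ^ (t + m - 1) : ℝ) : ℂ) /
                  (1 - z * (starRingEnd ℂ) w) ^ ((t + m + 1 : ℝ) : ℂ) ∂nuM)
            + ∑ j ∈ Finset.Icc 1 (m - 1),
                ∫ w, opR b w * (starRingEnd ℂ) (w * deriv f w) *
                  (((1 - ‖w‖ ^ 2) ^ (t + j) : ℝ) : ℂ) /
                  (1 - z * (starRingEnd ℂ) w) ^ ((t + j + 1 : ℝ) : ℂ) ∂nuM := by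
  intro z hz
  obtain ⟨M, hM⟩ := hbB
  obtain ⟨C, hC⟩ := hf.deriv.exists_norm_le
  obtain ⟨C₂, hC₂⟩ := hf.deriv.deriv.exists_norm_le
  have hG : DifferentiableOn ℂ (opR b) UD :=
    hb.add (differentiableOn_id.mul (hb.deriv Metric.isOpen_ball))
  have hF := hf.deriv.differentiableOn
  have hF₂ := hf.deriv.deriv.differentiableOn
  have hm' : (2 : ℝ) ≤ m := by exact_mod_cast hm
  have hI := integrable_cauchy_kernel (p := t + 1) (s := t + 1) hz (by linarith) (by linarith)
    hG.continuousOn hF.continuousOn hM hC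
  have hA := integrable_phase_kernel (p := t + m) (s := t + m) hz (by linarith) (by linarith)
    hG.continuousOn hF₂.continuousOn hM hC₂
  have hB := integrable_cauchy_kernel (p := t + m) (s := t + m) hz (by linarith) (by linarith)
    hG.continuousOn hF.continuousOn hM hC
  have hD := integrable_conj_sub_kernel (p := t + m - 1) (s := t + m + 1) hz (by linarith)
    (by linarith) hG.continuousOn hF.continuousOn hM hC
  have hQ : ∀ j ∈ Finset.Icc 1 (m - 1),
      Integrable (fun w => opR b w * (starRingEnd ℂ) (w * deriv f w) *
        (((1 - ‖w‖ ^ 2) ^ (t + j) : ℝ) : ℂ) /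
        (1 - z * (starRingEnd ℂ) w) ^ ((t + j + 1 : ℝ) : ℂ)) nuM := fun j hj => by
    have hj' : (1 : ℝ) ≤ j := by exact_mod_cast (Finset.mem_Icc.1 hj).1
    exact integrable_radial_kernel hz (by linarith) (by linarith) hG.continuousOn
      hF.continuousOn hM hC
  refine ⟨hI, hA, hD, hQ, ?_⟩
  rw [← integral_modified_cauchy_kernel hz (by linarith) hG hF hM hC hA hB hD,
    ← integral_finsetSum _ hQ, ← integral_add hB (integrable_finsetSum _ hQ)]
  refine integral_congr_ae ?_
  filter_upwards [ae_nuM_mem, ae_nuM_ne z] with w hw hwz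
  have h := cauchy_kernel_expansion (t := t) hz hw hwz (m - 1)
  rw [Nat.sub_add_cancel (by omega)] at h
  rw [mul_div_assoc, h, mul_add, Finset.mul_sum, mul_div_assoc]
  refine congrArg _ (Finset.sum_congr rfl fun j _ => ?_)
  rw [map_mul]
  ring
end
end
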